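/- Let $c > 1$ and let $a : \mathbb{N} \to \mathbb{N}$ satisfy $a(n+1) > c \cdot a(n)$ for all $n$. Then there is a set of $\alpha \in [0,1]$ of full Lebesgue measure such that for all $k \ge 2$ and all $f \in C_c^\infty(\mathbb{R}^{k-1})$, the $k$-level correlation sums $R_k(f,N)(\alpha)$ converge to $\int_{\mathbb{R}^{k-1}} f(x)\, dx$ as $N \to \infty$. -/

import Mathlib

open MeasureTheory

/-- The `k`-level correlation sum `R_k(f,N)(α)`. -/
noncomputable def Rk (a : ℕ → ℕ) (k : ℕ) (f : (Fin (k - 1) → ℝ) → ℝ) (N : ℕ) (α : ℝ) : ℝ :=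
  (1 / (N : ℝ)) *
    ∑ x ∈ (Fintype.piFinset fun _ : Fin k => Finset.Icc 1 N).filter Function.Injective,
      ∑' m : Fin (k - 1) → ℤ,
        f fun i => (N : ℝ) * ((m i : ℝ) + α *
          ((a (x ⟨i.1, by have := i.2; omega⟩) : ℝ) -
           (a (x ⟨i.1 + 1, by have := i.2; omega⟩) : ℝ)))

open Filter

/-- Lebesgue measure on the unit interval `(0, 1]`. -/
noncomputable def unitVol : Measure ℝ := volume.restrict (Set.Ioc (0 : ℝ) 1)

instance : IsProbabilityMeasure unitVol := ⟨by simp [unitVol]⟩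

lemma integral_unitVol (f : ℝ → ℝ) : ∫ x, f x ∂unitVol = ∫ x in (0 : ℝ)..1, f x := by
  rw [intervalIntegral.integral_of_le zero_le_one, unitVol]

lemma integrable_unitVol {f : ℝ → ℝ} (hf : Continuous f) : Integrable f unitVol := by
  exact (hf.intervalIntegrable (μ := volume) 0 1).1

lemma integrable_unitVol_prod {f : ℝ × ℝ → ℝ} (hf : Continuous f) :
    Integrable f (unitVol.prod unitVol) := by
  rw [unitVol, Measure.prod_restrict]
  exact (hf.continuousOn.integrableOn_compact (isCompact_Icc.prod isCompact_Icc)).mono_set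
    (Set.prod_mono Set.Ioc_subset_Icc_self Set.Ioc_subset_Icc_self)

/-- The integral of a periodic function over the unit interval is shift invariant. -/
lemma integral_unitVol_add {φ : ℝ → ℝ} (hp : Function.Periodic φ 1) (t : ℝ) :
    ∫ x, φ (x + t) ∂unitVol = ∫ x, φ x ∂unitVol := by
  rw [integral_unitVol, integral_unitVol, intervalIntegral.integral_comp_add_right,
    zero_add, add_comm]
  simpa using hp.intervalIntegral_add_eq t 0

/-- A nonzero integer dilation followed by a shift preserves the mean of a periodic function. -/
lemma integral_unitVol_mul_add {φ : ℝ → ℝ} (hc : Continuous φ) (hp : Function.Periodic φ 1)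
    {h : ℤ} (hh : h ≠ 0) (t : ℝ) :
    ∫ x, φ (h * x + t) ∂unitVol = ∫ x, φ x ∂unitVol := by
  have h0 : (h : ℝ) ≠ 0 := by exact_mod_cast hh
  have key := hp.intervalIntegral_add_zsmul_eq h t (fun _ _ => hc.intervalIntegrable _ _)
  rw [hp.intervalIntegral_add_eq t 0] at key
  rw [integral_unitVol, integral_unitVol, intervalIntegral.integral_comp_mul_add _ h0]
  simp only [zsmul_eq_mul, mul_one, zero_add, smul_eq_mul, mul_zero] at key ⊢
  rw [add_comm, key]
  field_simp

/-- A nonnegative `1`-periodic function bounded by `B` and Lipschitz with constant `K`. -/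
structure PerLip (B K : ℝ) (h : ℝ → ℝ) : Prop where
  nonneg : ∀ x, 0 ≤ h x
  le : ∀ x, h x ≤ B
  lip : ∀ x y, |h x - h y| ≤ K * |x - y|
  per : Function.Periodic h 1

lemma continuous_of_abs_sub_le {h : ℝ → ℝ} {K : ℝ} (hl : ∀ x y, |h x - h y| ≤ K * |x - y|) :
    Continuous h := by
  have : LipschitzWith K.toNNReal h := LipschitzWith.of_dist_le_mul fun x y => by
    rw [Real.dist_eq, Real.dist_eq]
    exact (hl x y).trans (mul_le_mul_of_nonneg_right (Real.le_coe_toNNReal K) (abs_nonneg _))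
  exact this.continuous

namespace PerLip

variable {B K : ℝ} {h : ℝ → ℝ}

lemma continuous (hh : PerLip B K h) : Continuous h := continuous_of_abs_sub_le hh.lip

lemma shift (hh : PerLip B K h) (t : ℝ) : PerLip B K fun x => h (x + t) where
  nonneg x := hh.nonneg _
  le x := hh.le _
  lip x y := by simpa using hh.lip (x + t) (y + t)
  per x := by
    have := hh.per (x + t)
    simp only at this ⊢
    rw [← this]; ring_nf

lemma mean_nonneg (hh : PerLip B K h) : 0 ≤ ∫ x, h x ∂unitVol := integral_nonneg hh.nonneg

lemma mean_le (hh : PerLip B K h) : ∫ x, h x ∂unitVol ≤ B := by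
  calc ∫ x, h x ∂unitVol ≤ ∫ x, B ∂unitVol :=
        integral_mono (integrable_unitVol hh.continuous) (integrable_const _) hh.le
    _ = B := by simp

end PerLip

/-- Decorrelation of a slowly varying periodic function from a rapidly oscillating one. -/
lemma abs_integral_mul_sub_le {φ h : ℝ → ℝ} {Λ B K : ℝ} (hφ : ∀ x y, |φ x - φ y| ≤ Λ * |x - y|)
    (hφp : Function.Periodic φ 1) (hΛ : 0 ≤ Λ) (hh : PerLip B K h) {q : ℕ} (hq : 0 < q) :
    |(∫ x, φ x * h (x * q) ∂unitVol) - (∫ x, φ x ∂unitVol) * ∫ x, h x ∂unitVol| ≤ Λ * B / q := by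
  have hq' : (0 : ℝ) < q := by exact_mod_cast hq
  have hφc := continuous_of_abs_sub_le hφ
  have hhc := hh.continuous
  have hB : 0 ≤ B := (hh.nonneg 0).trans (hh.le 0)
  have hper : Function.Periodic (fun x => φ x * h (x * q)) 1 := by
    intro x
    have h2 := hh.per.nat_mul q (x * q)
    simp only [hφp x, add_mul, one_mul]
    rw [← h2, mul_one]
  have step : ∀ u ∈ Set.Ioc (0 : ℝ) 1,
      |(∫ x, φ x * h (x * q) ∂unitVol) - ∫ x, φ x * h (x * q + u) ∂unitVol| ≤ Λ * B / q := by
    intro u hu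
    have e1 : ∫ x, φ x * h (x * q) ∂unitVol = ∫ x, φ (x + u / q) * h (x * q + u) ∂unitVol := by
      rw [← integral_unitVol_add hper (u / q)]
      congr 1; ext x; congr 2; field_simp
    rw [e1, ← integral_sub (integrable_unitVol (by fun_prop)) (integrable_unitVol (by fun_prop))]
    have : ∀ x, ‖φ (x + u / q) * h (x * q + u) - φ x * h (x * q + u)‖ ≤ Λ * B / q := by
      intro x
      rw [← sub_mul, norm_mul, Real.norm_eq_abs, Real.norm_eq_abs, abs_of_nonneg (hh.nonneg _)]
      have h1 := hφ (x + u / q) x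
      rw [add_sub_cancel_left, abs_of_nonneg (div_nonneg hu.1.le hq'.le)] at h1
      calc _ ≤ Λ * (u / q) * B := mul_le_mul h1 (hh.le _) (hh.nonneg _)
            (mul_nonneg hΛ (div_nonneg hu.1.le hq'.le))
        _ = Λ * B / q * u := by ring
        _ ≤ Λ * B / q * 1 := by
            apply mul_le_mul_of_nonneg_left hu.2; positivity
        _ = _ := mul_one _
    simpa using norm_integral_le_of_norm_le_const (μ := unitVol) (Eventually.of_forall this)
  have hF : Continuous (Function.uncurry fun u x => φ x * h (x * q + u)) := by
    simp only [Function.uncurry_def]; fun_prop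
  have e2 : ∫ u, ∫ x, φ x * h (x * q + u) ∂unitVol ∂unitVol
      = (∫ x, φ x ∂unitVol) * ∫ x, h x ∂unitVol := by
    rw [integral_integral_swap (integrable_unitVol_prod hF), ← integral_mul_const]
    congr 1; ext x
    rw [integral_const_mul]
    congr 1
    simpa [add_comm] using integral_unitVol_add hh.per (x * q)
  have e3 : (∫ x, φ x * h (x * q) ∂unitVol) - (∫ x, φ x ∂unitVol) * ∫ x, h x ∂unitVol
      = ∫ u, ((∫ x, φ x * h (x * q) ∂unitVol) - ∫ x, φ x * h (x * q + u) ∂unitVol) ∂unitVol := by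
    rw [integral_sub (integrable_const _), e2]
    · simp
    · exact (integrable_unitVol_prod hF).integral_prod_left
  rw [e3]
  have : ∀ᵐ u ∂unitVol, ‖(∫ x, φ x * h (x * q) ∂unitVol)
      - ∫ x, φ x * h (x * q + u) ∂unitVol‖ ≤ Λ * B / q := by
    rw [unitVol]
    filter_upwards [ae_restrict_mem measurableSet_Ioc] with u hu using step u hu
  simpa using norm_integral_le_of_norm_le_const this

lemma abs_prod_sub_prod_le {ι : Type*} [DecidableEq ι] {B : ℝ} (hB : 1 ≤ B) (S : Finset ι)
    (u v : ι → ℝ) {δ : ℝ} (hu : ∀ i ∈ S, 0 ≤ u i ∧ u i ≤ B) (hv : ∀ i ∈ S, 0 ≤ v i ∧ v i ≤ B)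
    (h : ∀ i ∈ S, |u i - v i| ≤ δ) :
    |∏ i ∈ S, u i - ∏ i ∈ S, v i| ≤ S.card * B ^ S.card * δ := by
  induction S using Finset.induction_on with
  | empty => simp
  | insert i S hi ih =>
    rw [Finset.prod_insert hi, Finset.prod_insert hi, Finset.card_insert_of_notMem hi]
    have ih := ih (fun j hj => hu j (Finset.mem_insert_of_mem hj))
      (fun j hj => hv j (Finset.mem_insert_of_mem hj)) (fun j hj => h j (Finset.mem_insert_of_mem hj))
    have hui := hu i (Finset.mem_insert_self _ _)
    have hi' := h i (Finset.mem_insert_self _ _)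
    have hδ : 0 ≤ δ := (abs_nonneg _).trans hi'
    have hP : |∏ j ∈ S, v j| ≤ B ^ S.card := by
      rw [Finset.abs_prod, ← Finset.prod_const]
      refine Finset.prod_le_prod (fun _ _ => abs_nonneg _) fun j hj => ?_
      have := hv j (Finset.mem_insert_of_mem hj)
      rw [abs_of_nonneg this.1]; exact this.2
    have e : u i * ∏ j ∈ S, u j - v i * ∏ j ∈ S, v j
        = u i * (∏ j ∈ S, u j - ∏ j ∈ S, v j) + (u i - v i) * ∏ j ∈ S, v j := by ring
    rw [e]
    have hB0 : (0 : ℝ) ≤ B := by linarith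
    calc _ ≤ |u i| * |∏ j ∈ S, u j - ∏ j ∈ S, v j| + |u i - v i| * |∏ j ∈ S, v j| := by
          rw [← abs_mul, ← abs_mul]; exact abs_add_le _ _
      _ ≤ B * (S.card * B ^ S.card * δ) + δ * B ^ S.card := by
          gcongr
          · rw [abs_of_nonneg hui.1]; exact hui.2
      _ ≤ B * (S.card * B ^ S.card * δ) + B * (δ * B ^ S.card) := by
          exact add_le_add le_rfl (le_mul_of_one_le_left (by positivity) hB)
      _ = _ := by push_cast; ring

lemma periodic_prod_mul {ι : Type*} (S : Finset ι) (b : ι → ℕ) {h : ι → ℝ → ℝ}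
    (hp : ∀ i ∈ S, Function.Periodic (h i) 1) :
    Function.Periodic (fun x => ∏ i ∈ S, h i (x * b i)) 1 := by
  intro x
  refine Finset.prod_congr rfl fun i hi => ?_
  have h2 := (hp i hi).nat_mul (b i) (x * b i)
  rw [add_mul, one_mul, ← h2, mul_one]

/-- Frequencies growing by a factor at least `Q` make the corresponding factors nearly
independent. -/
lemma abs_integral_prod_sub_le {ι : Type*} [DecidableEq ι] {B K Q : ℝ} (hB : 1 ≤ B) (hK : 0 ≤ K)
    (hQ : 0 < Q) (S : Finset ι) (b : ι → ℕ) (h : ι → ℝ → ℝ) (hh : ∀ i ∈ S, PerLip B K (h i))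
    (hb : ∀ i ∈ S, 0 < b i)
    (hsep : ∀ i ∈ S, ∀ j ∈ S, i ≠ j → b i ≤ b j → Q * b i ≤ b j) :
    |(∫ x, ∏ i ∈ S, h i (x * b i) ∂unitVol) - ∏ i ∈ S, ∫ x, h i x ∂unitVol|
      ≤ S.card ^ 2 * B ^ S.card * K / Q := by
  have hB0 : (0 : ℝ) ≤ B := by linarith
  induction S using Finset.induction_on_max_value b with
  | empty => simp
  | insert i S hi hmax ih =>
    have ih := ih (fun j hj => hh j (Finset.mem_insert_of_mem hj))
      (fun j hj => hb j (Finset.mem_insert_of_mem hj))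
      (fun j hj l hl => hsep j (Finset.mem_insert_of_mem hj) l (Finset.mem_insert_of_mem hl))
    have hS : ∀ j ∈ S, PerLip B K (h j) := fun j hj => hh j (Finset.mem_insert_of_mem hj)
    have hhi := hh i (Finset.mem_insert_self _ _)
    have hbi := hb i (Finset.mem_insert_self _ _)
    have hbi' : (0 : ℝ) < b i := by exact_mod_cast hbi
    have hlip : ∀ x y, |∏ j ∈ S, h j (x * b j) - ∏ j ∈ S, h j (y * b j)|
        ≤ S.card * B ^ S.card * (K * (b i / Q)) * |x - y| := by
      intro x y
      refine (abs_prod_sub_prod_le hB S _ _ (δ := K * (b i / Q) * |x - y|)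
        (fun j hj => ⟨(hS j hj).nonneg _, (hS j hj).le _⟩)
        (fun j hj => ⟨(hS j hj).nonneg _, (hS j hj).le _⟩) fun j hj => ?_).trans (le_of_eq (by ring))
      refine ((hS j hj).lip _ _).trans ?_
      rw [← sub_mul, abs_mul, Nat.abs_cast]
      have h1 : (b j : ℝ) ≤ b i / Q := by
        rw [le_div_iff₀ hQ, mul_comm]
        exact hsep j (Finset.mem_insert_of_mem hj) i (Finset.mem_insert_self _ _)
          (fun e => hi (e ▸ hj)) (hmax j hj)
      calc _ = K * b j * |x - y| := by ring
        _ ≤ _ := by gcongr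
    have key := abs_integral_mul_sub_le hlip
      (periodic_prod_mul S b fun j hj => (hS j hj).per) (by positivity) hhi hbi
    simp only [Finset.prod_insert hi, Finset.card_insert_of_notMem hi]
    have hm := hhi.mean_nonneg
    have hm' := hhi.mean_le
    set m := ∫ x, h i x ∂unitVol
    set P := ∫ x, ∏ j ∈ S, h j (x * b j) ∂unitVol
    set R := ∏ j ∈ S, ∫ x, h j x ∂unitVol
    have e : ∫ x, h i (x * b i) * ∏ j ∈ S, h j (x * b j) ∂unitVol
        = ∫ x, (∏ j ∈ S, h j (x * b j)) * h i (x * b i) ∂unitVol := by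
      congr 1; ext x; ring
    rw [e]
    set I := ∫ x, (∏ j ∈ S, h j (x * b j)) * h i (x * b i) ∂unitVol
    have e2 : I - m * R = (I - P * m) + m * (P - R) := by ring
    rw [e2]
    calc _ ≤ |I - P * m| + m * |P - R| := by
          refine (abs_add_le _ _).trans ?_
          rw [abs_mul, abs_of_nonneg hm]
      _ ≤ S.card * B ^ S.card * (K * (b i / Q)) * B / b i
            + B * (S.card ^ 2 * B ^ S.card * K / Q) := by gcongr
      _ = (S.card + S.card ^ 2) * B ^ (S.card + 1) * K / Q := by
          field_simp; ring
      _ ≤ _ := by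
          push_cast
          gcongr
          nlinarith [Nat.cast_nonneg (α := ℝ) S.card]

/-- Two indices at distance less than `L`. -/
def Near (L y y' : ℕ) : Prop := y < y' + L ∧ y' < y + L

instance (L y y' : ℕ) : Decidable (Near L y y') := inferInstanceAs (Decidable (_ ∧ _))

lemma card_filter_near_le (T : Finset ℕ) (L y : ℕ) : (T.filter (Near L y)).card ≤ 2 * L := by
  have : T.filter (Near L y) ⊆ Finset.Ico (y + 1 - L) (y + L) := by
    intro z hz
    obtain ⟨_, h1, h2⟩ := Finset.mem_filter.1 hz
    rw [Finset.mem_Ico]; omega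
  refine (Finset.card_le_card this).trans ?_
  rw [Nat.card_Ico]; omega

section Tuples

variable {ι : Type*} [Fintype ι] [DecidableEq ι]

lemma sum_filter_prod_eq {i j : ι} (hij : i ≠ j) (T : Finset ℕ) (u : ι → ℕ → ℝ)
    (ρ : ℕ → ℕ → Prop) [∀ y y', Decidable (ρ y y')] :
    ∑ z ∈ (Fintype.piFinset fun _ : ι => T).filter (fun z => ρ (z i) (z j)), ∏ l, u l (z l)
      = (∑ p ∈ (T ×ˢ T).filter (fun p => ρ p.1 p.2), u i p.1 * u j p.2)
        * ∏ l ∈ (Finset.univ.erase i).erase j, ∑ y ∈ T, u l y := by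
  classical
  rw [← Finset.sum_fiberwise_of_maps_to (s := (Fintype.piFinset fun _ : ι => T).filter
    (fun z => ρ (z i) (z j))) (t := (T ×ˢ T).filter (fun p => ρ p.1 p.2))
    (g := fun z => (z i, z j)), Finset.sum_mul]
  · refine Finset.sum_congr rfl fun p hp => ?_
    obtain ⟨hp1, hp2⟩ := Finset.mem_filter.1 hp
    obtain ⟨h1, h2⟩ := Finset.mem_product.1 hp1
    have e : ((Fintype.piFinset fun _ : ι => T).filter (fun z => ρ (z i) (z j))).filter
        (fun z => (z i, z j) = p)
        = Fintype.piFinset fun l => if l = i then {p.1} else if l = j then {p.2} else T := by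
      ext z
      simp only [Finset.mem_filter, Fintype.mem_piFinset, Prod.ext_iff]
      constructor
      · rintro ⟨⟨hz, _⟩, hi, hj⟩ l
        split_ifs with h h'
        · subst h; simpa using hi
        · subst h'; simpa using hj
        · exact hz l
      · intro hz
        have hi : z i = p.1 := by simpa using hz i
        have hj : z j = p.2 := by simpa [hij.symm] using hz j
        refine ⟨⟨fun l => ?_, by rw [hi, hj]; exact hp2⟩, hi, hj⟩
        by_cases h : l = i
        · subst h; rw [hi]; exact h1
        by_cases h' : l = j
        · subst h'; rw [hj]; exact h2
        simpa [h, h'] using hz l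
    rw [e, ← Finset.prod_univ_sum, ← Finset.mul_prod_erase _ _ (Finset.mem_univ i),
      ← Finset.mul_prod_erase (Finset.univ.erase i) _ (Finset.mem_erase.2 ⟨hij.symm, Finset.mem_univ j⟩),
      ← mul_assoc]
    congr 1
    · simp [hij.symm]
    · refine Finset.prod_congr rfl fun l hl => ?_
      simp only [Finset.mem_erase, Finset.mem_univ, and_true] at hl
      simp [hl.1, hl.2]
  · intro z hz
    simp only [Finset.mem_filter, Fintype.mem_piFinset, Finset.mem_product] at hz ⊢
    exact ⟨⟨hz.1 i, hz.1 j⟩, hz.2⟩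

lemma sum_filter_exists_le (T : Finset ℕ) (u : ι → ℕ → ℝ) (hu : ∀ l y, 0 ≤ u l y)
    (ρ : ι → ι → ℕ → ℕ → Prop) [∀ i j y y', Decidable (ρ i j y y')]
    (A : Finset (ι → ℕ)) (hA : ∀ z ∈ A, (∀ l, z l ∈ T) ∧ ∃ i j, i ≠ j ∧ ρ i j (z i) (z j)) :
    ∑ z ∈ A, ∏ l, u l (z l) ≤ ∑ p ∈ (Finset.univ : Finset ι).offDiag,
      (∑ y ∈ (T ×ˢ T).filter (fun y => ρ p.1 p.2 y.1 y.2), u p.1 y.1 * u p.2 y.2)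
        * ∏ l ∈ (Finset.univ.erase p.1).erase p.2, ∑ y ∈ T, u l y := by
  classical
  have hnn : ∀ z : ι → ℕ, 0 ≤ ∏ l, u l (z l) := fun z => Finset.prod_nonneg fun l _ => hu l _
  calc ∑ z ∈ A, ∏ l, u l (z l)
      ≤ ∑ z ∈ A, ∑ p ∈ (Finset.univ : Finset ι).offDiag,
          if ρ p.1 p.2 (z p.1) (z p.2) then ∏ l, u l (z l) else 0 := by
        refine Finset.sum_le_sum fun z hz => ?_
        obtain ⟨_, i, j, hij, hr⟩ := hA z hz
        have : (i, j) ∈ (Finset.univ : Finset ι).offDiag := by simp [hij]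
        refine le_trans ?_ (Finset.single_le_sum (f := fun p : ι × ι =>
          if ρ p.1 p.2 (z p.1) (z p.2) then ∏ l, u l (z l) else 0) (fun p _ => ?_) this)
        · simp [hr]
        · split_ifs
          · exact hnn z
          · exact le_rfl
    _ ≤ ∑ z ∈ Fintype.piFinset fun _ : ι => T, ∑ p ∈ (Finset.univ : Finset ι).offDiag,
          if ρ p.1 p.2 (z p.1) (z p.2) then ∏ l, u l (z l) else 0 := by
        refine Finset.sum_le_sum_of_subset_of_nonneg
          (fun z hz => Fintype.mem_piFinset.2 (hA z hz).1) fun z _ _ =>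
          Finset.sum_nonneg fun p _ => ?_
        split_ifs
        · exact hnn z
        · exact le_rfl
    _ = _ := by
        rw [Finset.sum_comm]
        refine Finset.sum_congr rfl fun p hp => ?_
        rw [← Finset.sum_filter]
        exact sum_filter_prod_eq (Finset.mem_offDiag.1 hp).2.2 T u (ρ p.1 p.2)

/-- Tuples from `T` whose entries are pairwise at distance at least `L`. -/
def sepTuples (ι : Type*) [Fintype ι] [DecidableEq ι] (L : ℕ) (T : Finset ℕ) : Finset (ι → ℕ) :=
  (Fintype.piFinset fun _ : ι => T).filter fun z => ∀ i j, i ≠ j → ¬ Near L (z i) (z j)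

lemma mem_sepTuples {L : ℕ} {T : Finset ℕ} {z : ι → ℕ} :
    z ∈ sepTuples ι L T ↔ (∀ l, z l ∈ T) ∧ ∀ i j, i ≠ j → ¬ Near L (z i) (z j) := by
  rw [sepTuples, Finset.mem_filter, Fintype.mem_piFinset]

end Tuples

lemma sum_near_mul_le (T : Finset ℕ) (L : ℕ) (u v : ℕ → ℝ) {B : ℝ} (hB : 0 ≤ B)
    (hu : ∀ y, 0 ≤ u y) (hv : ∀ y, v y ≤ B) :
    ∑ y ∈ (T ×ˢ T).filter (fun y => Near L y.1 y.2), u y.1 * v y.2 ≤ 2 * L * B * ∑ y ∈ T, u y := by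
  rw [Finset.sum_filter, Finset.sum_product, Finset.mul_sum]
  refine Finset.sum_le_sum fun y _ => ?_
  rw [← Finset.sum_filter]
  calc ∑ y' ∈ T.filter (Near L y), u y * v y' ≤ ∑ y' ∈ T.filter (Near L y), u y * B :=
        Finset.sum_le_sum fun y' _ => mul_le_mul_of_nonneg_left (hv y') (hu y)
    _ = (T.filter (Near L y)).card * (u y * B) := by simp
    _ ≤ (2 * L : ℕ) * (u y * B) := by
        have := card_filter_near_le T L y
        have h2 := mul_nonneg (hu y) hB
        gcongr
    _ = _ := by push_cast; ring

lemma sum_near_mul_le_pow (T : Finset ℕ) (L q : ℕ) (u : ℕ → ℝ) {B : ℝ} (hB : 0 ≤ B)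
    (hu : ∀ y, 0 ≤ u y) (hv : ∀ y, u y ≤ B) :
    (∑ y ∈ T, u y) ^ q ≤ ∑ z ∈ sepTuples (Fin q) L T, ∏ l, u (z l)
      + q ^ 2 * (2 * L * B) * (∑ y ∈ T, u y) ^ (q - 1) := by
  have h1 : (∑ y ∈ T, u y) ^ q = ∑ z ∈ Fintype.piFinset fun _ : Fin q => T, ∏ l, u (z l) := by
    rw [← Finset.prod_univ_sum (t := fun _ : Fin q => T) (f := fun _ y => u y)]; simp
  have hX : 0 ≤ ∑ y ∈ T, u y := Finset.sum_nonneg fun y _ => hu y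
  rw [h1, ← Finset.sum_filter_add_sum_filter_not _
    (fun z : Fin q → ℕ => ∀ i j, i ≠ j → ¬ Near L (z i) (z j))]
  refine add_le_add (le_of_eq (by rw [sepTuples]; congr!)) ?_
  refine (sum_filter_exists_le T (fun _ y => u y) (fun _ y => hu y) (fun _ _ => Near L) _ ?_).trans ?_
  · intro z hz
    obtain ⟨h1, h2⟩ := Finset.mem_filter.1 hz
    push Not at h2
    exact ⟨Fintype.mem_piFinset.1 h1, h2⟩
  · have : ∀ p ∈ (Finset.univ : Finset (Fin q)).offDiag,
        (∑ y ∈ (T ×ˢ T).filter (fun y => Near L y.1 y.2), u y.1 * u y.2)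
        * ∏ l ∈ (Finset.univ.erase p.1).erase p.2, ∑ y ∈ T, u y
        ≤ (2 * L * B) * (∑ y ∈ T, u y) ^ (q - 1) := by
      intro p hp
      have hne := (Finset.mem_offDiag.1 hp).2.2
      have hcard : ((Finset.univ.erase p.1).erase p.2).card + 1 = q - 1 := by
        rw [Finset.card_erase_of_mem (by simp [hne.symm]), Finset.card_erase_of_mem (by simp),
          Finset.card_univ, Fintype.card_fin]
        have := p.1.2
        have := p.2.2
        have : p.1.1 ≠ p.2.1 := fun h => hne (Fin.ext h)
        omega
      rw [Finset.prod_const, ← hcard, pow_succ', ← mul_assoc]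
      exact mul_le_mul_of_nonneg_right (sum_near_mul_le T L u u hB hu hv) (pow_nonneg hX _)
    refine (Finset.sum_le_sum this).trans ?_
    rw [Finset.sum_const, nsmul_eq_mul, mul_assoc (_ ^ 2)]
    refine mul_le_mul_of_nonneg_right ?_ (mul_nonneg (by positivity) (pow_nonneg hX _))
    rw [Finset.offDiag_card, Finset.card_univ, Fintype.card_fin, sq]
    exact_mod_cast Nat.sub_le _ _

/-- High powers of a sum are controlled by separated tuples. -/
lemma pow_sum_le (T : Finset ℕ) (L q : ℕ) (u : ℕ → ℝ) {B : ℝ} (hB : 0 ≤ B)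
    (hu : ∀ y, 0 ≤ u y) (hv : ∀ y, u y ≤ B) :
    (∑ y ∈ T, u y) ^ q ≤ 2 * ∑ z ∈ sepTuples (Fin q) L T, ∏ l, u (z l)
      + (4 * q ^ 2 * L * B) ^ q := by
  have h := sum_near_mul_le_pow T L q u hB hu hv
  have hX : 0 ≤ ∑ y ∈ T, u y := Finset.sum_nonneg fun y _ => hu y
  have hS : 0 ≤ ∑ z ∈ sepTuples (Fin q) L T, ∏ l, u (z l) :=
    Finset.sum_nonneg fun z _ => Finset.prod_nonneg fun l _ => hu _
  set X := ∑ y ∈ T, u y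
  set S := ∑ z ∈ sepTuples (Fin q) L T, ∏ l, u (z l)
  by_cases hc : X ≤ 4 * q ^ 2 * L * B
  · have := pow_le_pow_left₀ hX hc q
    linarith
  · push Not at hc
    have hD : 0 ≤ (4 * q ^ 2 * L * B) ^ q := by positivity
    rcases Nat.eq_zero_or_pos q with rfl | hq
    · simp only [pow_zero] at h ⊢; linarith
    have : q ^ 2 * (2 * L * B) * X ^ (q - 1) ≤ X ^ q / 2 := by
      have e : X ^ q = X * X ^ (q - 1) := by rw [← pow_succ']; congr 1; omega
      rw [e]
      have := mul_le_mul_of_nonneg_right hc.le (pow_nonneg hX (q - 1))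
      nlinarith
    linarith

/-- Lebesgue measure on the unit cube, with coordinates `(α, s, s')`. -/
noncomputable def unitVol₃ : Measure (ℝ × ℝ × ℝ) := unitVol.prod (unitVol.prod unitVol)

lemma integrable_unitVol₃ {f : ℝ × ℝ × ℝ → ℝ} (hf : Continuous f) : Integrable f unitVol₃ := by
  rw [unitVol₃, unitVol, Measure.prod_restrict, Measure.prod_restrict]
  exact (hf.continuousOn.integrableOn_compact
    (isCompact_Icc.prod (isCompact_Icc.prod isCompact_Icc))).mono_set
    (Set.prod_mono Set.Ioc_subset_Icc_self
      (Set.prod_mono Set.Ioc_subset_Icc_self Set.Ioc_subset_Icc_self))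

instance : IsProbabilityMeasure unitVol₃ := by unfold unitVol₃; infer_instance

lemma integral_unitVol₃ {f : ℝ × ℝ × ℝ → ℝ} (hf : Continuous f) :
    ∫ ω, f ω ∂unitVol₃ = ∫ α, ∫ s, ∫ s', f (α, s, s') ∂unitVol ∂unitVol ∂unitVol := by
  rw [unitVol₃, integral_prod _ (integrable_unitVol₃ hf)]
  congr 1; ext α
  exact integral_prod _ (integrable_unitVol_prod (by fun_prop))

lemma integral_unitVol₃_symm {f : ℝ × ℝ × ℝ → ℝ} (hf : Continuous f) :
    ∫ ω, f ω ∂unitVol₃ = ∫ p, ∫ α, f (α, p) ∂unitVol ∂(unitVol.prod unitVol) :=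
  integral_prod_symm _ (integrable_unitVol₃ hf)

lemma integral_unitVol₃_le {f : ℝ × ℝ × ℝ → ℝ} (hf : Continuous f) {C : ℝ}
    (h : ∀ p, ∫ α, f (α, p) ∂unitVol ≤ C) : ∫ ω, f ω ∂unitVol₃ ≤ C := by
  rw [integral_unitVol₃_symm hf]
  calc _ ≤ ∫ p, C ∂(unitVol.prod unitVol) :=
        integral_mono (integrable_unitVol₃ hf).integral_prod_right (integrable_const _) h
    _ = C := by simp

section Moments

variable {a : ℕ → ℕ} {L : ℕ} {B K Q : ℝ}

lemma abs_integral_prod_sub_le_of_sep {ι : Type*} [Fintype ι] [DecidableEq ι] (hpos : ∀ n, 0 < a n)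
    (hmono : StrictMono a) (hL : 1 ≤ L) (hgap : ∀ y y', y + L ≤ y' → Q * a y ≤ a y')
    (hB : 1 ≤ B) (hK : 0 ≤ K) (hQ : 0 < Q) (z : ι → ℕ) (hz : ∀ i j, i ≠ j → ¬ Near L (z i) (z j))
    (h : ι → ℝ → ℝ) (hh : ∀ i, PerLip B K (h i)) :
    |(∫ x, ∏ i, h i (x * a (z i)) ∂unitVol) - ∏ i, ∫ x, h i x ∂unitVol|
      ≤ Fintype.card ι ^ 2 * B ^ Fintype.card ι * K / Q := by
  refine abs_integral_prod_sub_le hB hK hQ Finset.univ (fun i => a (z i)) h (fun i _ => hh i)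
    (fun i _ => hpos _) fun i _ j _ hij hle => ?_
  have := hz i j hij
  rw [Near] at this
  rcases le_or_gt (z i + L) (z j) with h1 | h1
  · exact hgap _ _ h1
  · have : z j < z i := by omega
    exact absurd (hmono this) (not_lt.2 hle)

lemma card_sepTuples_le (ι : Type*) [Fintype ι] [DecidableEq ι] (L : ℕ) (T : Finset ℕ) :
    (sepTuples ι L T).card ≤ T.card ^ Fintype.card ι := by
  refine (Finset.card_filter_le _ _).trans ?_
  simp

lemma integral_pow_sum_le (hpos : ∀ n, 0 < a n) (hmono : StrictMono a) (hL : 1 ≤ L)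
    (hgap : ∀ y y', y + L ≤ y' → Q * a y ≤ a y') (hB : 1 ≤ B) (hK : 0 ≤ K) (hQ : 0 < Q)
    (T : Finset ℕ) (hT : 0 < T.card) {W : ℝ → ℝ} (hW : PerLip B K W) {β : ℝ}
    (hβ : ∫ x, W x ∂unitVol = β / T.card) (q : ℕ)
    (hq : (T.card : ℝ) ^ q * (q ^ 2 * B ^ q * K / Q) ≤ 1) (s : ℝ) :
    ∫ α, (∑ y ∈ T, W (α * a y + s)) ^ q ∂unitVol ≤ 2 * (β ^ q + 1) + (4 * q ^ 2 * L * B) ^ q := by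
  have hWc := hW.continuous
  have hB0 : (0 : ℝ) ≤ B := by linarith
  have hN : (0 : ℝ) < T.card := by exact_mod_cast hT
  calc _ ≤ ∫ α, (2 * ∑ z ∈ sepTuples (Fin q) L T, ∏ l, W (α * a (z l) + s)
            + (4 * q ^ 2 * L * B) ^ q) ∂unitVol := by
        refine integral_mono (integrable_unitVol (by fun_prop)) (integrable_unitVol (by fun_prop)) ?_
        intro α
        exact pow_sum_le T L q (fun y => W (α * a y + s)) hB0 (fun _ => hW.nonneg _) fun _ => hW.le _
    _ = 2 * ∑ z ∈ sepTuples (Fin q) L T, ∫ α, ∏ l, W (α * a (z l) + s) ∂unitVol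
          + (4 * q ^ 2 * L * B) ^ q := by
        rw [integral_add (integrable_unitVol (by fun_prop)) (integrable_const _),
          integral_const_mul, integral_finsetSum]
        · simp
        · exact fun z _ => integrable_unitVol (by fun_prop)
    _ ≤ 2 * ∑ z ∈ sepTuples (Fin q) L T, ((β / T.card) ^ q + q ^ 2 * B ^ q * K / Q)
          + (4 * q ^ 2 * L * B) ^ q := by
        gcongr with z hz
        have := abs_integral_prod_sub_le_of_sep hpos hmono hL hgap hB hK hQ z
          (mem_sepTuples.1 hz).2 (fun _ x => W (x + s)) (fun _ => hW.shift s)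
        simp only [integral_unitVol_add hW.per, hβ, Finset.prod_const, Finset.card_univ,
          Fintype.card_fin] at this
        linarith [(abs_le.1 this).2]
    _ ≤ 2 * ((T.card : ℝ) ^ q * ((β / T.card) ^ q + q ^ 2 * B ^ q * K / Q))
          + (4 * q ^ 2 * L * B) ^ q := by
        have h1 := card_sepTuples_le (Fin q) L T
        have h0 : 0 ≤ β / T.card := hβ ▸ hW.mean_nonneg
        rw [Finset.sum_const, nsmul_eq_mul]
        rw [Fintype.card_fin] at h1
        gcongr
        exact_mod_cast h1
    _ = 2 * (β ^ q + (T.card : ℝ) ^ q * (q ^ 2 * B ^ q * K / Q)) + (4 * q ^ 2 * L * B) ^ q := by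
        rw [mul_add, div_pow, mul_div_cancel₀ _ (by positivity)]
    _ ≤ _ := by gcongr

/-- The shift variable attached to each of the `2k` indices. -/
def shiftOf {k : ℕ} : Fin k ⊕ Fin k → ℝ × ℝ → ℝ := Sum.elim (fun _ p => p.1) fun _ p => p.2

@[fun_prop]
lemma continuous_shiftOf {k : ℕ} (i : Fin k ⊕ Fin k) : Continuous (shiftOf i) := by
  cases i <;> simp only [shiftOf, Sum.elim_inl, Sum.elim_inr] <;> fun_prop

lemma integral_mul_same_shift {W : ℝ → ℝ} (hc : Continuous W) (hp : Function.Periodic W 1)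
    {b b' : ℕ} (hb : b ≠ b') :
    ∫ α, ∫ s, W (α * b + s) * W (α * b' + s) ∂unitVol ∂unitVol = (∫ x, W x ∂unitVol) ^ 2 := by
  have e1 : ∀ α : ℝ, ∫ s, W (α * b + s) * W (α * b' + s) ∂unitVol
      = ∫ s, W s * W (((b' - b : ℤ) : ℝ) * α + s) ∂unitVol := by
    intro α
    have hper : Function.Periodic (fun s => W s * W (((b' - b : ℤ) : ℝ) * α + s)) 1 := by
      intro s
      simp only [← add_assoc, hp _]
    rw [← integral_unitVol_add hper (α * b)]
    congr 1; ext s; congr 2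
    · ring
    · push_cast; ring
  simp only [e1]
  rw [integral_integral_swap (integrable_unitVol_prod (by
    simp only [Function.uncurry_def]; fun_prop)), sq, ← integral_mul_const]
  congr 1; ext s
  rw [integral_const_mul, integral_unitVol_mul_add hc hp (sub_ne_zero.2 (by exact_mod_cast hb.symm))]

lemma integral_mul_shiftOf {k : ℕ} {W : ℝ → ℝ} (hc : Continuous W) (hp : Function.Periodic W 1)
    (i j : Fin k ⊕ Fin k) {b b' : ℕ} (hb : i.isLeft = j.isLeft → b ≠ b') :
    ∫ ω, W (ω.1 * b + shiftOf i ω.2) * W (ω.1 * b' + shiftOf j ω.2) ∂unitVol₃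
      = (∫ x, W x ∂unitVol) ^ 2 := by
  rw [integral_unitVol₃ (by fun_prop)]
  have hs : ∀ t, ∫ s, W (t + s) ∂unitVol = ∫ x, W x ∂unitVol := fun t => by
    simpa [add_comm] using integral_unitVol_add hp t
  rcases i with i | i <;> rcases j with j | j <;>
    simp only [shiftOf, Sum.elim_inl, Sum.elim_inr, Sum.isLeft_inl, Sum.isLeft_inr, forall_const,
      reduceCtorEq, false_implies] at hb ⊢
  · simpa using integral_mul_same_shift hc hp hb
  · simp only [integral_const_mul, integral_mul_const, hs]; simp [sq]
  · simp only [integral_const_mul, integral_mul_const, hs]; simp [sq]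
  · simpa using integral_mul_same_shift hc hp hb

end Moments

section SecondMoment

variable {a : ℕ → ℕ} {L : ℕ} {B K Q : ℝ}

lemma mul_prod_le_add_div {ι : Type*} [DecidableEq ι] {D V lam : ℝ} (hD : 0 ≤ D) (hDV : D ≤ V ^ 2)
    (hV : 1 ≤ V) (hlam : 0 < lam) (S : Finset ι) (X : ι → ℝ) (hX : ∀ l, 0 ≤ X l)
    (hXV : ∀ l, X l ≤ V) {n : ℕ} (hS : S.card ≤ n) :
    D * ∏ l ∈ S, X l ≤ lam * D + V ^ (2 * n + 2) / lam := by
  have hV0 : 0 ≤ V := by linarith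
  have h1 : ∏ l ∈ S, X l ≤ V ^ n := by
    calc _ ≤ ∏ l ∈ S, V := Finset.prod_le_prod (fun l _ => hX l) fun l _ => hXV l
      _ = V ^ S.card := by simp
      _ ≤ V ^ n := pow_le_pow_right₀ hV hS
  have h2 : V ^ n ≤ lam + (V ^ n) ^ 2 / lam := by
    rw [← sub_nonneg]
    have : lam + (V ^ n) ^ 2 / lam - V ^ n = ((lam - V ^ n / 2) ^ 2 + 3 / 4 * (V ^ n) ^ 2) / lam := by
      field_simp; ring
    rw [this]; positivity
  calc D * ∏ l ∈ S, X l ≤ D * (lam + (V ^ n) ^ 2 / lam) :=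
        mul_le_mul_of_nonneg_left (h1.trans h2) hD
    _ = lam * D + D * ((V ^ n) ^ 2 / lam) := by ring
    _ ≤ lam * D + V ^ 2 * ((V ^ n) ^ 2 / lam) := by gcongr
    _ = _ := by ring

lemma max_pow_le_add (X Y : ℝ) (hX : 0 ≤ X) (hY : 0 ≤ Y) (q : ℕ) :
    (max 1 (max X Y)) ^ q ≤ 1 + X ^ q + Y ^ q := by
  have := pow_nonneg hX q
  have := pow_nonneg hY q
  rcases max_cases 1 (max X Y) with ⟨h, _⟩ | ⟨h, _⟩
  · rw [h, one_pow]; linarith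
  · rw [h]
    rcases max_cases X Y with ⟨h, _⟩ | ⟨h, _⟩ <;> rw [h] <;> linarith

/-- The contribution of `2k`-tuples with two nearby entries to the second moment. -/
lemma integral_sum_near_le {k : ℕ} (T : Finset ℕ) (hT : 0 < T.card) {W : ℝ → ℝ}
    (hW : PerLip B K W) {β : ℝ} (hβ : ∫ x, W x ∂unitVol = β / T.card) {M lam : ℝ}
    (hM : ∀ s, ∫ α, (∑ y ∈ T, W (α * a y + s)) ^ (2 * (2 * k) + 2) ∂unitVol ≤ M) (hlam : 0 < lam)
    (hinj : Function.Injective a) (A : Finset (Fin k ⊕ Fin k → ℕ))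
    (hA : ∀ z ∈ A, (∀ l, z l ∈ T) ∧
      ∃ i j, i ≠ j ∧ (Near L (z i) (z j) ∧ (i.isLeft = j.isLeft → z i ≠ z j))) :
    ∫ ω, ∑ z ∈ A, ∏ l, W (ω.1 * a (z l) + shiftOf l ω.2) ∂unitVol₃
      ≤ (2 * k) ^ 2 * (lam * (2 * L * β ^ 2 / T.card) + (1 + 2 * M) / lam) := by
  have hWc := hW.continuous
  have hN : (0 : ℝ) < T.card := by exact_mod_cast hT
  set ρ : Fin k ⊕ Fin k → Fin k ⊕ Fin k → ℕ → ℕ → Prop :=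
    fun i j y y' => Near L y y' ∧ (i.isLeft = j.isLeft → y ≠ y') with hρ
  set D : (Fin k ⊕ Fin k) × (Fin k ⊕ Fin k) → ℝ × ℝ × ℝ → ℝ := fun p ω =>
    ∑ y ∈ (T ×ˢ T).filter (fun y => ρ p.1 p.2 y.1 y.2),
      W (ω.1 * a y.1 + shiftOf p.1 ω.2) * W (ω.1 * a y.2 + shiftOf p.2 ω.2) with hDdef
  set X : ℝ → ℝ → ℝ := fun α s => ∑ y ∈ T, W (α * a y + s) with hXdef
  have hX0 : ∀ α s, 0 ≤ X α s := fun α s => Finset.sum_nonneg fun y _ => hW.nonneg _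
  have hDc : ∀ p, Continuous (D p) := fun p => by simp only [hDdef]; fun_prop
  have hXc : ∀ q : ℕ, Continuous fun ω : ℝ × ℝ × ℝ =>
      (1 + X ω.1 ω.2.1 ^ q + X ω.1 ω.2.2 ^ q) / lam := fun q => by
    simp only [hXdef]; fun_prop
  have hpt : ∀ ω : ℝ × ℝ × ℝ, ∑ z ∈ A, ∏ l, W (ω.1 * a (z l) + shiftOf l ω.2)
      ≤ ∑ p ∈ (Finset.univ : Finset (Fin k ⊕ Fin k)).offDiag, (lam * D p ω
        + (1 + X ω.1 ω.2.1 ^ (2 * (2 * k) + 2) + X ω.1 ω.2.2 ^ (2 * (2 * k) + 2)) / lam) := by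
    intro ω
    refine (sum_filter_exists_le T (fun (l : Fin k ⊕ Fin k) y => W (ω.1 * a y + shiftOf l ω.2))
      (fun _ _ => hW.nonneg _) ρ A hA).trans (Finset.sum_le_sum fun p hp => ?_)
    set V := max 1 (max (X ω.1 ω.2.1) (X ω.1 ω.2.2))
    have hXV : ∀ l : Fin k ⊕ Fin k, ∑ y ∈ T, W (ω.1 * a y + shiftOf l ω.2) ≤ V := by
      rintro (l | l)
      · exact (le_max_left _ _).trans (le_max_right _ _)
      · exact (le_max_right _ _).trans (le_max_right _ _)
    have hV1 : 1 ≤ V := le_max_left _ _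
    have hD0 : 0 ≤ D p ω := Finset.sum_nonneg fun y _ => mul_nonneg (hW.nonneg _) (hW.nonneg _)
    have hDV : D p ω ≤ V ^ 2 := by
      calc D p ω ≤ ∑ y ∈ T ×ˢ T,
            W (ω.1 * a y.1 + shiftOf p.1 ω.2) * W (ω.1 * a y.2 + shiftOf p.2 ω.2) :=
            Finset.sum_le_sum_of_subset_of_nonneg (Finset.filter_subset _ _)
              fun y _ _ => mul_nonneg (hW.nonneg _) (hW.nonneg _)
        _ = (∑ y ∈ T, W (ω.1 * a y + shiftOf p.1 ω.2))
              * ∑ y ∈ T, W (ω.1 * a y + shiftOf p.2 ω.2) := by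
            rw [Finset.sum_product, Finset.sum_mul_sum]
        _ ≤ V * V := mul_le_mul (hXV _) (hXV _) (Finset.sum_nonneg fun y _ => hW.nonneg _)
            (by linarith)
        _ = V ^ 2 := (sq V).symm
    refine (mul_prod_le_add_div (n := 2 * k) hD0 hDV hV1 hlam _ _
      (fun l => Finset.sum_nonneg fun y _ => hW.nonneg _) hXV ?_).trans ?_
    · refine (Finset.card_le_univ _).trans (le_of_eq ?_)
      simp [two_mul]
    · gcongr
      exact max_pow_le_add _ _ (hX0 _ _) (hX0 _ _) _
  have hED : ∀ p, ∫ ω, D p ω ∂unitVol₃ ≤ 2 * L * β ^ 2 / T.card := by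
    intro p
    simp only [hDdef]
    rw [integral_finsetSum _ fun y _ => integrable_unitVol₃ (by fun_prop)]
    calc _ = ∑ y ∈ (T ×ˢ T).filter (fun y => ρ p.1 p.2 y.1 y.2), (β / T.card) ^ 2 := by
          refine Finset.sum_congr rfl fun y hy => ?_
          rw [integral_mul_shiftOf hWc hW.per, hβ]
          exact fun e h => (Finset.mem_filter.1 hy).2.2 e (hinj h)
      _ ≤ ∑ y ∈ (T ×ˢ T).filter (fun y => Near L y.1 y.2), (β / T.card) ^ 2 := by
          refine Finset.sum_le_sum_of_subset_of_nonneg (fun y hy => ?_) fun _ _ _ => sq_nonneg _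
          obtain ⟨h1, h2⟩ := Finset.mem_filter.1 hy
          exact Finset.mem_filter.2 ⟨h1, h2.1⟩
      _ = (β / T.card) ^ 2 * ∑ y ∈ (T ×ˢ T).filter (fun y => Near L y.1 y.2), (1 : ℝ) * 1 := by
          rw [Finset.mul_sum]; simp
      _ ≤ (β / T.card) ^ 2 * (2 * L * 1 * ∑ y ∈ T, (1 : ℝ)) := by
          gcongr
          exact sum_near_mul_le T L (fun _ => 1) (fun _ => 1) zero_le_one (fun _ => zero_le_one)
            fun _ => le_rfl
      _ = _ := by simp; field_simp
  have hEX : ∫ ω, (1 + X ω.1 ω.2.1 ^ (2 * (2 * k) + 2) + X ω.1 ω.2.2 ^ (2 * (2 * k) + 2)) / lam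
      ∂unitVol₃ ≤ (1 + 2 * M) / lam := by
    refine integral_unitVol₃_le (hXc _) fun p => ?_
    rw [integral_div]
    gcongr
    have hi : ∀ s, Integrable (fun α => X α s ^ (2 * (2 * k) + 2)) unitVol := fun s =>
      integrable_unitVol (by simp only [hXdef]; fun_prop)
    have hi' : Integrable (fun α => 1 + X α p.1 ^ (2 * (2 * k) + 2)) unitVol :=
      integrable_unitVol (by simp only [hXdef]; fun_prop)
    simp only
    rw [integral_add hi' (hi _), integral_add (integrable_const _) (hi _)]
    have h1 := hM p.1
    have h2 := hM p.2
    simp only [integral_const, probReal_univ, smul_eq_mul, mul_one]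
    linarith
  have hc1 : ∀ p, Continuous fun ω => lam * D p ω := fun p => (hDc p).const_mul lam
  have hc2 : ∀ p, Continuous fun ω => lam * D p ω
      + (1 + X ω.1 ω.2.1 ^ (2 * (2 * k) + 2) + X ω.1 ω.2.2 ^ (2 * (2 * k) + 2)) / lam :=
    fun p => (hc1 p).add (hXc _)
  calc _ ≤ ∫ ω, ∑ p ∈ (Finset.univ : Finset (Fin k ⊕ Fin k)).offDiag, (lam * D p ω
        + (1 + X ω.1 ω.2.1 ^ (2 * (2 * k) + 2) + X ω.1 ω.2.2 ^ (2 * (2 * k) + 2)) / lam)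
        ∂unitVol₃ :=
        integral_mono (integrable_unitVol₃ (by fun_prop)) (integrable_unitVol₃ (continuous_finsetSum
          _ fun p _ => hc2 p)) hpt
    _ = ∑ p ∈ (Finset.univ : Finset (Fin k ⊕ Fin k)).offDiag, (lam * ∫ ω, D p ω ∂unitVol₃
        + ∫ ω, (1 + X ω.1 ω.2.1 ^ (2 * (2 * k) + 2) + X ω.1 ω.2.2 ^ (2 * (2 * k) + 2)) / lam
        ∂unitVol₃) := by
        rw [integral_finsetSum _ fun p _ => integrable_unitVol₃ (hc2 p)]
        refine Finset.sum_congr rfl fun p _ => ?_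
        rw [integral_add (integrable_unitVol₃ (hc1 p)) (integrable_unitVol₃ (hXc _)),
          integral_const_mul]
    _ ≤ ∑ p ∈ (Finset.univ : Finset (Fin k ⊕ Fin k)).offDiag,
        (lam * (2 * L * β ^ 2 / T.card) + (1 + 2 * M) / lam) := by
        refine Finset.sum_le_sum fun p _ => add_le_add ?_ hEX
        exact mul_le_mul_of_nonneg_left (hED p) hlam.le
    _ ≤ _ := by
        have hM0 : 0 ≤ M := (integral_nonneg fun α => pow_nonneg (hX0 α 0) _).trans (hM 0)
        rw [Finset.sum_const, nsmul_eq_mul]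
        have : (0 : ℝ) ≤ lam * (2 * L * β ^ 2 / T.card) + (1 + 2 * M) / lam := by positivity
        gcongr
        rw [Finset.offDiag_card, Finset.card_univ, Fintype.card_sum, Fintype.card_fin]
        have : (k + k) * (k + k) - (k + k) ≤ (2 * k) ^ 2 := by
          refine (Nat.sub_le _ _).trans (le_of_eq (by ring))
        exact_mod_cast this

end SecondMoment

/-- Injective `k`-tuples with entries in `T`. -/
def injTuples (k : ℕ) (T : Finset ℕ) : Finset (Fin k → ℕ) :=
  (Fintype.piFinset fun _ : Fin k => T).filter Function.Injective

lemma mem_injTuples {k : ℕ} {T : Finset ℕ} {x : Fin k → ℕ} :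
    x ∈ injTuples k T ↔ (∀ i, x i ∈ T) ∧ Function.Injective x := by
  rw [injTuples, Finset.mem_filter, Fintype.mem_piFinset]

/-- Pairs of injective `k`-tuples with entries in `T`. -/
def injPairs (k : ℕ) (T : Finset ℕ) : Finset (Fin k ⊕ Fin k → ℕ) :=
  (Fintype.piFinset fun _ : Fin k ⊕ Fin k => T).filter fun z =>
    Function.Injective (z ∘ Sum.inl) ∧ Function.Injective (z ∘ Sum.inr)

lemma mem_injPairs {k : ℕ} {T : Finset ℕ} {z : Fin k ⊕ Fin k → ℕ} :
    z ∈ injPairs k T ↔ (∀ i, z i ∈ T) ∧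
      Function.Injective (z ∘ Sum.inl) ∧ Function.Injective (z ∘ Sum.inr) := by
  rw [injPairs, Finset.mem_filter, Fintype.mem_piFinset]

/-- The sum over injective tuples of the product of the functions `G i`, evaluated at points
shifted by `s`. -/
noncomputable def corrSum {k : ℕ} (a : ℕ → ℕ) (T : Finset ℕ) (G : Fin k → ℝ → ℝ) (α s : ℝ) : ℝ :=
  ∑ x ∈ injTuples k T, ∏ i, G i (α * a (x i) + s)

lemma corrSum_mul_corrSum {k : ℕ} (a : ℕ → ℕ) (T : Finset ℕ) (G : Fin k → ℝ → ℝ)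
    (ω : ℝ × ℝ × ℝ) :
    corrSum a T G ω.1 ω.2.1 * corrSum a T G ω.1 ω.2.2
      = ∑ z ∈ injPairs k T, ∏ l, Sum.elim G G l (ω.1 * a (z l) + shiftOf l ω.2) := by
  rw [corrSum, corrSum, Finset.sum_mul_sum, ← Finset.sum_product']
  refine Finset.sum_bij' (fun p _ => Sum.elim p.1 p.2) (fun z _ => (z ∘ Sum.inl, z ∘ Sum.inr))
    ?_ ?_ ?_ ?_ ?_
  · rintro ⟨x, y⟩ h
    obtain ⟨h1, h2⟩ := Finset.mem_product.1 h
    rw [mem_injTuples] at h1 h2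
    rw [mem_injPairs]
    refine ⟨?_, by simpa using h1.2, by simpa using h2.2⟩
    rintro (i | i)
    · exact h1.1 i
    · exact h2.1 i
  · intro z hz
    rw [mem_injPairs] at hz
    rw [Finset.mem_product, mem_injTuples, mem_injTuples]
    exact ⟨⟨fun i => hz.1 _, hz.2.1⟩, fun i => hz.1 _, hz.2.2⟩
  · simp
  · simp
  · simp [Fintype.prod_sum_type, shiftOf]

section SecondMoment

variable {a : ℕ → ℕ} {k L : ℕ} {B K Q : ℝ}

lemma sum_card_sepTuples_ge (k L : ℕ) (T : Finset ℕ) (hT : 0 < T.card) :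
    (T.card : ℝ) ^ k * (1 - 2 * k ^ 2 * L / T.card) ≤ (sepTuples (Fin k) L T).card := by
  have hN : (0 : ℝ) < T.card := by exact_mod_cast hT
  have h := sum_near_mul_le_pow T L k (fun _ => 1) zero_le_one (fun _ => zero_le_one) (fun _ => le_rfl)
  simp only [Finset.sum_const, nsmul_eq_mul, mul_one, Finset.prod_const_one] at h
  rcases Nat.eq_zero_or_pos k with rfl | hk
  · norm_num at h ⊢
    exact h
  have e : (T.card : ℝ) ^ k = T.card * (T.card : ℝ) ^ (k - 1) := by
    rw [← pow_succ']; congr 1; omega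
  have e2 : (T.card : ℝ) ^ k * (1 - 2 * k ^ 2 * L / T.card)
      = (T.card : ℝ) ^ k - k ^ 2 * (2 * L) * (T.card : ℝ) ^ (k - 1) := by
    rw [e]; field_simp
  rw [e2]; linarith

lemma card_pow_mul_le {N : ℝ} (hN : 1 ≤ N) (hB : 1 ≤ B) (hK : 0 ≤ K) (hQ : 0 < Q) {p q : ℕ}
    (hpq : p ≤ q) (hq : N ^ (q + 1) * (q ^ 2 * B ^ q * K / Q) ≤ 1) :
    N ^ p * (p ^ 2 * B ^ p * K / Q) ≤ 1 / N := by
  have h0 : 0 < N := by linarith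
  rw [le_div_iff₀ h0]
  refine le_trans ?_ hq
  have h1 : N ^ p ≤ N ^ q := pow_le_pow_right₀ hN hpq
  have h2 : B ^ p ≤ B ^ q := pow_le_pow_right₀ hB hpq
  calc _ = N ^ p * N * (p ^ 2 * B ^ p * K / Q) := by ring
    _ ≤ N ^ q * N * (q ^ 2 * B ^ q * K / Q) := by gcongr
    _ = _ := by rw [pow_succ N q]

@[fun_prop]
lemma continuous_corrSum (T : Finset ℕ) {G : Fin k → ℝ → ℝ}
    (hG : ∀ i, Continuous (G i)) :
    Continuous fun p : ℝ × ℝ => corrSum a T G p.1 p.2 := by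
  unfold corrSum; fun_prop

lemma integral_corrSum_ge
    (hpos : ∀ n, 0 < a n) (hmono : StrictMono a) (hL : 1 ≤ L)
    (hgap : ∀ y y', y + L ≤ y' → Q * a y ≤ a y') (hB : 1 ≤ B) (hK : 0 ≤ K) (hQ : 0 < Q)
    (T : Finset ℕ) (hT : 0 < T.card) {G : Fin k → ℝ → ℝ} (hG : ∀ i, PerLip B K (G i))
    {μ : Fin k → ℝ} (hμ : ∀ i, ∫ x, G i x ∂unitVol = μ i / T.card)
    (hq : (T.card : ℝ) ^ k * (k ^ 2 * B ^ k * K / Q) ≤ 1 / T.card) :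
    (∏ i, μ i) - 2 * k ^ 2 * L / T.card * (∏ i, μ i) - 1 / T.card
      ≤ ∫ α, ∫ s, corrSum a T G α s ∂unitVol ∂unitVol := by
  have hN : (0 : ℝ) < T.card := by exact_mod_cast hT
  have hGc : ∀ i, Continuous (G i) := fun i => (hG i).continuous
  have hμ0 : ∀ i, 0 ≤ μ i := fun i => by
    have := (hG i).mean_nonneg
    rw [hμ i] at this
    have h2 := mul_nonneg this hN.le
    rwa [div_mul_cancel₀ _ hN.ne'] at h2
  have hμp : 0 ≤ ∏ i, μ i := Finset.prod_nonneg fun i _ => hμ0 i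
  set δ : ℝ := k ^ 2 * B ^ k * K / Q
  have hB0 : 0 ≤ B := by linarith
  have hδ : 0 ≤ δ := by positivity
  rw [integral_integral_swap (integrable_unitVol_prod (by
    simp only [Function.uncurry_def]; fun_prop))]
  have key : ∀ s, (∏ i, μ i) - 2 * k ^ 2 * L / T.card * (∏ i, μ i) - 1 / T.card
      ≤ ∫ α, corrSum a T G α s ∂unitVol := by
    intro s
    have hsub : sepTuples (Fin k) L T ⊆ injTuples k T := by
      intro x hx
      rw [mem_sepTuples] at hx
      rw [mem_injTuples]
      refine ⟨hx.1, fun i j hij => ?_⟩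
      by_contra hne
      refine hx.2 i j hne ?_
      rw [hij, Near]; omega
    calc _ = (T.card : ℝ) ^ k * (1 - 2 * k ^ 2 * L / T.card) * ((∏ i, μ i) / (T.card : ℝ) ^ k)
          - 1 / T.card := by field_simp
      _ ≤ (sepTuples (Fin k) L T).card * ((∏ i, μ i) / (T.card : ℝ) ^ k)
          - (T.card : ℝ) ^ k * δ := by
          have := sum_card_sepTuples_ge k L T hT
          gcongr
      _ ≤ (sepTuples (Fin k) L T).card * ((∏ i, μ i) / (T.card : ℝ) ^ k)
          - (sepTuples (Fin k) L T).card * δ := by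
          have := card_sepTuples_le (Fin k) L T
          rw [Fintype.card_fin] at this
          gcongr
          exact_mod_cast this
      _ = ∑ x ∈ sepTuples (Fin k) L T, ((∏ i, μ i) / (T.card : ℝ) ^ k - δ) := by
          rw [Finset.sum_const, nsmul_eq_mul]; ring
      _ ≤ ∑ x ∈ sepTuples (Fin k) L T, ∫ α, ∏ i, G i (α * a (x i) + s) ∂unitVol := by
          refine Finset.sum_le_sum fun x hx => ?_
          have := abs_integral_prod_sub_le_of_sep hpos hmono hL hgap hB hK hQ x
            (mem_sepTuples.1 hx).2 (fun i y => G i (y + s)) (fun i => (hG i).shift s)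
          simp only [integral_unitVol_add (hG _).per, hμ, Fintype.card_fin, Finset.prod_div_distrib,
            Finset.prod_const, Finset.card_univ] at this
          linarith [(abs_le.1 this).1]
      _ ≤ ∑ x ∈ injTuples k T, ∫ α, ∏ i, G i (α * a (x i) + s) ∂unitVol :=
          Finset.sum_le_sum_of_subset_of_nonneg hsub fun x _ _ =>
            integral_nonneg fun α => Finset.prod_nonneg fun i _ => (hG i).nonneg _
      _ = _ := by
          simp only [corrSum]
          rw [integral_finsetSum]
          exact fun x _ => integrable_unitVol (by fun_prop)
  calc _ = ∫ s, ((∏ i, μ i) - 2 * k ^ 2 * L / T.card * (∏ i, μ i) - 1 / T.card) ∂unitVol := by simp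
    _ ≤ _ := integral_mono (integrable_const _) (integrable_unitVol_prod (f := fun p : ℝ × ℝ =>
        corrSum a T G p.2 p.1) (by unfold corrSum; fun_prop)).integral_prod_left key

lemma integral_corrSum_mul_le
    (hpos : ∀ n, 0 < a n) (hmono : StrictMono a) (hL : 1 ≤ L)
    (hgap : ∀ y y', y + L ≤ y' → Q * a y ≤ a y') (hB : 1 ≤ B) (hK : 0 ≤ K) (hQ : 0 < Q)
    (T : Finset ℕ) (hT : 0 < T.card) {G : Fin k → ℝ → ℝ} (hG : ∀ i, PerLip B K (G i))
    {μ : Fin k → ℝ} (hμ : ∀ i, ∫ x, G i x ∂unitVol = μ i / T.card)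
    (hq : (T.card : ℝ) ^ (2 * k) * ((2 * k : ℕ) ^ 2 * B ^ (2 * k) * K / Q) ≤ 1 / T.card)
    {W : ℝ → ℝ} (hW : PerLip B K W) (hGW : ∀ i x, G i x ≤ W x) {β M lam : ℝ}
    (hβ : ∫ x, W x ∂unitVol = β / T.card)
    (hM : ∀ s, ∫ α, (∑ y ∈ T, W (α * a y + s)) ^ (2 * (2 * k) + 2) ∂unitVol ≤ M)
    (hlam : 0 < lam) :
    ∫ ω, corrSum a T G ω.1 ω.2.1 * corrSum a T G ω.1 ω.2.2 ∂unitVol₃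
      ≤ (∏ i, μ i) ^ 2 + 1 / T.card
        + (2 * k) ^ 2 * (lam * (2 * L * β ^ 2 / T.card) + (1 + 2 * M) / lam) := by
  have hN : (0 : ℝ) < T.card := by exact_mod_cast hT
  have hGc : ∀ i, Continuous (G i) := fun i => (hG i).continuous
  have hWc := hW.continuous
  have hG' : ∀ l, PerLip B K (Sum.elim G G l) := by
    rintro (i | i)
    · exact hG i
    · exact hG i
  have hG'c : ∀ l, Continuous (Sum.elim G G l) := fun l => (hG' l).continuous
  have hG'W : ∀ l x, Sum.elim G G l x ≤ W x := by
    rintro (i | i) x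
    · exact hGW i x
    · exact hGW i x
  set δ : ℝ := (2 * k : ℕ) ^ 2 * B ^ (2 * k) * K / Q
  have hB0 : 0 ≤ B := by linarith
  have hδ : 0 ≤ δ := by positivity
  set S := sepTuples (Fin k ⊕ Fin k) L T
  have hcont : ∀ A : Finset (Fin k ⊕ Fin k → ℕ), Continuous fun ω : ℝ × ℝ × ℝ =>
      ∑ z ∈ A, ∏ l, Sum.elim G G l (ω.1 * a (z l) + shiftOf l ω.2) := fun A => by fun_prop
  have hsep : ∫ ω, ∑ z ∈ S, ∏ l, Sum.elim G G l (ω.1 * a (z l) + shiftOf l ω.2) ∂unitVol₃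
      ≤ (∏ i, μ i) ^ 2 + 1 / T.card := by
    refine integral_unitVol₃_le (hcont S) fun p => ?_
    simp only
    rw [integral_finsetSum _ fun z _ => integrable_unitVol (by fun_prop)]
    calc _ ≤ ∑ z ∈ S, ((∏ i, μ i) ^ 2 / (T.card : ℝ) ^ (2 * k) + δ) := by
          refine Finset.sum_le_sum fun z hz => ?_
          have := abs_integral_prod_sub_le_of_sep hpos hmono hL hgap hB hK hQ z
            (mem_sepTuples.1 hz).2 (fun l y => Sum.elim G G l (y + shiftOf l p))
            (fun l => (hG' l).shift _)
          simp only [integral_unitVol_add (hG' _).per, Fintype.card_sum, Fintype.card_fin,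
            Fintype.prod_sum_type, Sum.elim_inl, Sum.elim_inr, hμ, Finset.prod_div_distrib,
            Finset.prod_const, Finset.card_univ, ← two_mul k, ← mul_div_mul_comm] at this
          have e : (∏ i, μ i) ^ 2 / (T.card : ℝ) ^ (2 * k)
            = ((∏ i, μ i) * ∏ i, μ i) / ((T.card : ℝ) ^ k * (T.card : ℝ) ^ k) := by
            rw [two_mul, pow_add, sq]
          rw [e]
          simp only [Fintype.prod_sum_type, Sum.elim_inl, Sum.elim_inr]
          linarith [(abs_le.1 this).2]
      _ ≤ (T.card : ℝ) ^ (2 * k) * ((∏ i, μ i) ^ 2 / (T.card : ℝ) ^ (2 * k) + δ) := by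
          have := card_sepTuples_le (Fin k ⊕ Fin k) L T
          rw [Fintype.card_sum, Fintype.card_fin, ← two_mul] at this
          rw [Finset.sum_const, nsmul_eq_mul]
          gcongr
          exact_mod_cast this
      _ = (∏ i, μ i) ^ 2 + (T.card : ℝ) ^ (2 * k) * δ := by
          rw [mul_add, mul_div_cancel₀ _ (by positivity)]
      _ ≤ _ := by gcongr
  set A := (injPairs k T).filter fun z => ¬ ∀ i j, i ≠ j → ¬ Near L (z i) (z j)
  have hnear := integral_sum_near_le T hT hW hβ hM hlam hmono.injective A (by
    intro z hz
    obtain ⟨h1, h2⟩ := Finset.mem_filter.1 hz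
    rw [mem_injPairs] at h1
    push Not at h2
    obtain ⟨i, j, hij, hn⟩ := h2
    refine ⟨h1.1, i, j, hij, hn, fun hs he => ?_⟩
    rcases i with i | i <;> rcases j with j | j <;> simp at hs hij
    · exact hij (h1.2.1 he)
    · exact hij (h1.2.2 he))
  have hnn : ∀ (z : Fin k ⊕ Fin k → ℕ) (ω : ℝ × ℝ × ℝ),
      0 ≤ ∏ l, Sum.elim G G l (ω.1 * a (z l) + shiftOf l ω.2) :=
    fun z ω => Finset.prod_nonneg fun l _ => (hG' l).nonneg _
  calc _ ≤ ∫ ω, ((∑ z ∈ S, ∏ l, Sum.elim G G l (ω.1 * a (z l) + shiftOf l ω.2))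
        + ∑ z ∈ A, ∏ l, W (ω.1 * a (z l) + shiftOf l ω.2)) ∂unitVol₃ := by
        refine integral_mono (integrable_unitVol₃ ?_) (integrable_unitVol₃ (by fun_prop)) ?_
        · unfold corrSum; fun_prop
        intro ω
        simp only
        rw [corrSum_mul_corrSum, ← Finset.sum_filter_add_sum_filter_not (injPairs k T)
          (fun z => ∀ i j, i ≠ j → ¬ Near L (z i) (z j))]
        refine add_le_add (Finset.sum_le_sum_of_subset_of_nonneg ?_ fun z _ _ => hnn z ω)
          (Finset.sum_le_sum fun z _ => Finset.prod_le_prod (fun l _ => (hG' l).nonneg _)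
            fun l _ => hG'W l _)
        intro z hz
        obtain ⟨h1, h2⟩ := Finset.mem_filter.1 hz
        exact mem_sepTuples.2 ⟨(mem_injPairs.1 h1).1, h2⟩
    _ = _ := integral_add (integrable_unitVol₃ (hcont S)) (integrable_unitVol₃ (by fun_prop))
    _ ≤ _ := add_le_add hsep hnear

/-- Variance bound for the smoothed correlation sums. -/
lemma integral_sq_corrSum_sub_le
    (hpos : ∀ n, 0 < a n) (hmono : StrictMono a) (hL : 1 ≤ L)
    (hgap : ∀ y y', y + L ≤ y' → Q * a y ≤ a y') (hB : 1 ≤ B) (hK : 0 ≤ K) (hQ : 0 < Q)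
    (T : Finset ℕ) (hT : 0 < T.card) {G : Fin k → ℝ → ℝ} (hG : ∀ i, PerLip B K (G i))
    {μ : Fin k → ℝ}
    (hμ : ∀ i, ∫ x, G i x ∂unitVol = μ i / T.card)
    (hq : (T.card : ℝ) ^ (4 * k + 3) * ((4 * k + 2 : ℕ) ^ 2 * B ^ (4 * k + 2) * K / Q) ≤ 1)
    {W : ℝ → ℝ} (hW : PerLip B K W) (hGW : ∀ i x, G i x ≤ W x) {β lam : ℝ}
    (hβ : ∫ x, W x ∂unitVol = β / T.card) (hlam : 0 < lam) :
    ∫ α, ((∫ s, corrSum a T G α s ∂unitVol) - ∏ i, μ i) ^ 2 ∂unitVol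
      ≤ (1 + 4 * k ^ 2 * L * (∏ i, μ i) ^ 2 + 2 * ∏ i, μ i) / T.card
        + (2 * k) ^ 2 * (lam * (2 * L * β ^ 2 / T.card)
          + (1 + 2 * (2 * (β ^ (4 * k + 2) + 1)
            + (4 * (4 * k + 2 : ℕ) ^ 2 * L * B) ^ (4 * k + 2))) / lam) := by
  have hN : (1 : ℝ) ≤ T.card := by exact_mod_cast hT
  have hN0 : (0 : ℝ) < T.card := by linarith
  have hGc : ∀ i, Continuous (G i) := fun i => (hG i).continuous
  have hμ0 : ∀ i, 0 ≤ μ i := fun i => by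
    have := (hG i).mean_nonneg
    rw [hμ i] at this
    have h2 := mul_nonneg this hN0.le
    rwa [div_mul_cancel₀ _ hN0.ne'] at h2
  have hμp : 0 ≤ ∏ i, μ i := Finset.prod_nonneg fun i _ => hμ0 i
  have hqq := card_pow_mul_le hN hB hK hQ (p := 4 * k + 2) (q := 4 * k + 2) le_rfl hq
  have h1 := integral_corrSum_ge hpos hmono hL hgap hB hK hQ T hT hG hμ
    (card_pow_mul_le hN hB hK hQ (q := 4 * k + 2) (by omega) hq)
  have h2 := integral_corrSum_mul_le hpos hmono hL hgap hB hK hQ T hT hG hμ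
    (card_pow_mul_le hN hB hK hQ (q := 4 * k + 2) (by omega) hq) hW hGW hβ (lam := lam)
    (M := 2 * (β ^ (4 * k + 2) + 1) + (4 * (4 * k + 2 : ℕ) ^ 2 * L * B) ^ (4 * k + 2))
    (fun s => by
      have e : 2 * (2 * k) + 2 = 4 * k + 2 := by ring
      rw [e]
      exact integral_pow_sum_le hpos hmono hL hgap hB hK hQ T hT hW hβ _
        (hqq.trans (div_le_one_of_le₀ hN hN0.le)) s) hlam
  rw [integral_unitVol₃ (by unfold corrSum; fun_prop)] at h2
  simp only [integral_const_mul, integral_mul_const, ← sq] at h2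
  have hc : Continuous fun α => ∫ s, corrSum a T G α s ∂unitVol := by
    simp only [integral_unitVol]
    exact intervalIntegral.continuous_parametric_intervalIntegral_of_continuous'
      (by simp only [Function.uncurry_def]; fun_prop) _ _
  set Z : ℝ → ℝ := fun α => ∫ s, corrSum a T G α s ∂unitVol with hZ
  have e : ∫ α, (Z α - ∏ i, μ i) ^ 2 ∂unitVol
      = ∫ α, Z α ^ 2 ∂unitVol - 2 * (∏ i, μ i) * ∫ α, Z α ∂unitVol + (∏ i, μ i) ^ 2 := by
    have : ∀ α, (Z α - ∏ i, μ i) ^ 2 = Z α ^ 2 - 2 * (∏ i, μ i) * Z α + (∏ i, μ i) ^ 2 :=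
      fun α => by ring
    simp only [this]
    rw [integral_add (integrable_unitVol (by fun_prop)) (integrable_const _),
      integral_sub (integrable_unitVol (by fun_prop)) (integrable_unitVol (by fun_prop)),
      integral_const_mul]
    simp
  have e' : ∀ α, Z α = ∫ s, corrSum a T G α s ∂unitVol := fun _ => rfl
  simp only [← e'] at h1 h2 ⊢
  rw [e]
  have h3 := mul_le_mul_of_nonneg_left h1 (mul_nonneg zero_le_two hμp)
  have e3 : (1 + 4 * k ^ 2 * L * (∏ i, μ i) ^ 2 + 2 * ∏ i, μ i) / (T.card : ℝ)
      = 1 / T.card + 2 * (∏ i, μ i) * (2 * k ^ 2 * L / T.card * ∏ i, μ i)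
        + 2 * (∏ i, μ i) * (1 / T.card) := by
    field_simp; ring
  rw [e3]
  linarith

end SecondMoment

/-- Lipschitz functions with values in `[0, 1]`, supported in `[-M, M]`. -/
structure Bump (M Λ : ℝ) (g : ℝ → ℝ) : Prop where
  nonneg : ∀ x, 0 ≤ g x
  le_one : ∀ x, g x ≤ 1
  lip : ∀ x y, |g x - g y| ≤ Λ * |x - y|
  supp : ∀ x, M < |x| → g x = 0

/-- The periodization of the dilate of `g` by `N`. -/
noncomputable def periodize (g : ℝ → ℝ) (N θ : ℝ) : ℝ := ∑' m : ℤ, g (N * (θ + m))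

/-- The integers `m` with `|θ + m| ≤ M`. -/
noncomputable def intsNear (M θ : ℝ) : Finset ℤ := Finset.Icc ⌈-M - θ⌉ ⌊M - θ⌋

lemma mem_intsNear {M θ : ℝ} {m : ℤ} : m ∈ intsNear M θ ↔ |θ + m| ≤ M := by
  rw [intsNear, Finset.mem_Icc, Int.ceil_le, Int.le_floor, abs_le]
  constructor <;> rintro ⟨h1, h2⟩ <;> constructor <;> linarith

lemma card_intsNear_le {M : ℝ} (hM : 0 ≤ M) (θ : ℝ) : ((intsNear M θ).card : ℝ) ≤ 2 * M + 1 := by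
  rw [intsNear, Int.card_Icc]
  have h1 := Int.floor_le (M - θ)
  have h2 := Int.le_ceil (-M - θ)
  rcases le_total 0 (⌊M - θ⌋ + 1 - ⌈-M - θ⌉) with h | h
  · have : (((⌊M - θ⌋ + 1 - ⌈-M - θ⌉).toNat : ℤ) : ℝ) = ((⌊M - θ⌋ + 1 - ⌈-M - θ⌉ : ℤ) : ℝ) := by
      rw [Int.toNat_of_nonneg h]
    rw [Int.cast_natCast] at this
    rw [this]; push_cast; linarith
  · rw [Int.toNat_of_nonpos h]; push_cast; linarith

namespace Bump

variable {M Λ : ℝ} {g : ℝ → ℝ}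

lemma continuous (hg : Bump M Λ g) : Continuous g := continuous_of_abs_sub_le hg.lip

lemma lip_nonneg (hg : Bump M Λ g) : 0 ≤ Λ := by simpa using (abs_nonneg _).trans (hg.lip 1 0)

lemma hasCompactSupport (hg : Bump M Λ g) : HasCompactSupport g :=
  HasCompactSupport.intro (isCompact_Icc (a := -M) (b := M)) fun x hx => hg.supp x <| by
    by_contra h
    exact hx (abs_le.1 (not_lt.1 h))

lemma integral_nonneg (hg : Bump M Λ g) : 0 ≤ ∫ x, g x := MeasureTheory.integral_nonneg hg.nonneg

lemma apply_eq_zero (hg : Bump M Λ g) {N θ : ℝ} (hN : 1 ≤ N) {m : ℤ} (hm : ¬ |θ + m| ≤ M) :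
    g (N * (θ + m)) = 0 := by
  refine hg.supp _ ?_
  rw [abs_mul, abs_of_nonneg (by linarith)]
  push Not at hm
  nlinarith [abs_nonneg (θ + m)]

lemma periodize_eq_sum (hg : Bump M Λ g) {N θ : ℝ} (hN : 1 ≤ N) {s : Finset ℤ}
    (hs : ∀ m : ℤ, |θ + m| ≤ M → m ∈ s) : periodize g N θ = ∑ m ∈ s, g (N * (θ + m)) :=
  tsum_eq_sum fun _ hm => hg.apply_eq_zero hN fun h => hm (hs _ h)

lemma perLip (hg : Bump M Λ g) (hM : 0 ≤ M) {N : ℝ} (hN : 1 ≤ N) :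
    PerLip (2 * M + 1) (2 * (2 * M + 1) * (Λ * N)) (periodize g N) where
  nonneg θ := tsum_nonneg fun _ => hg.nonneg _
  le θ := by
    rw [hg.periodize_eq_sum hN fun _ => mem_intsNear.2]
    refine le_trans ?_ (card_intsNear_le hM θ)
    calc _ ≤ ∑ m ∈ intsNear M θ, (1 : ℝ) := Finset.sum_le_sum fun _ _ => hg.le_one _
      _ = _ := by simp
  lip x y := by
    have hΛ := hg.lip_nonneg
    rw [hg.periodize_eq_sum hN (s := intsNear M x ∪ intsNear M y)
      (fun m hm => Finset.mem_union_left _ (mem_intsNear.2 hm)),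
      hg.periodize_eq_sum hN (s := intsNear M x ∪ intsNear M y)
      (fun m hm => Finset.mem_union_right _ (mem_intsNear.2 hm)), ← Finset.sum_sub_distrib]
    have hcard : ((intsNear M x ∪ intsNear M y).card : ℝ) ≤ 2 * (2 * M + 1) := by
      have h1 := card_intsNear_le hM x
      have h2 := card_intsNear_le hM y
      have : ((intsNear M x ∪ intsNear M y).card : ℝ)
          ≤ (intsNear M x).card + (intsNear M y).card := by
        exact_mod_cast Finset.card_union_le _ _
      linarith
    calc _ ≤ ∑ m ∈ intsNear M x ∪ intsNear M y, |g (N * (x + m)) - g (N * (y + m))| :=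
          Finset.abs_sum_le_sum_abs _ _
      _ ≤ ∑ m ∈ intsNear M x ∪ intsNear M y, Λ * N * |x - y| := by
          refine Finset.sum_le_sum fun m _ => (hg.lip _ _).trans (le_of_eq ?_)
          rw [← mul_sub, abs_mul, abs_of_nonneg (by linarith : (0 : ℝ) ≤ N), add_sub_add_right_eq_sub]
          ring
      _ = (intsNear M x ∪ intsNear M y).card * (Λ * N * |x - y|) := by simp
      _ ≤ 2 * (2 * M + 1) * (Λ * N * |x - y|) := by gcongr
      _ = _ := by ring
  per θ := by
    rw [periodize, periodize, ← (Equiv.addRight (1 : ℤ)).tsum_eq fun m : ℤ => g (N * (θ + m))]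
    congr 1; ext m
    simp only [Equiv.coe_addRight]; push_cast; ring_nf

/-- Unfolding: integrating a periodization against a periodic function. -/
lemma integral_periodize_mul (hg : Bump M Λ g) {N : ℝ} (hN : 1 ≤ N) {φ : ℝ → ℝ}
    (hφ : Continuous φ) (hp : Function.Periodic φ 1) :
    ∫ s, periodize g N s * φ s ∂unitVol = ∫ s, g (N * s) * φ s := by
  have hN0 : N ≠ 0 := by linarith
  have hgc := hg.continuous
  have hcs : HasCompactSupport fun s => g (N * s) * φ s := by
    have : HasCompactSupport fun s => g (N * s) :=
      hg.hasCompactSupport.comp_homeomorph (Homeomorph.mulLeft₀ N hN0)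
    exact this.mul_right
  have hInt : Integrable fun s => g (N * s) * φ s :=
    Continuous.integrable_of_hasCompactSupport (by fun_prop) hcs
  have hφi : ∀ (s : ℝ) (n : ℤ), φ (s + n) = φ s := fun s n => by
    simpa using hp.int_mul n s
  set A : Finset ℤ := Finset.Icc (-(⌈M⌉ + 1)) (⌈M⌉ + 1)
  have hA : ∀ s ∈ Set.uIcc (0 : ℝ) 1, ∀ m : ℤ, |s + m| ≤ M → m ∈ A := by
    intro s hs m hm
    rw [Set.uIcc_of_le zero_le_one] at hs
    rw [abs_le] at hm
    have h2 := Int.le_ceil M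
    have h3 : (-((⌈M⌉ : ℝ) + 1)) ≤ m := by linarith [hs.1, hs.2]
    have h4 : (m : ℝ) ≤ (⌈M⌉ : ℝ) + 1 := by linarith [hs.1, hs.2]
    rw [Finset.mem_Icc]
    exact ⟨by exact_mod_cast h3, by exact_mod_cast h4⟩
  have h1 : ∫ s, g (N * s) * φ s
      = ∑ n ∈ A, ∫ s in (0 : ℝ)..1, g (N * (s + n)) * φ (s + n) := by
    rw [← hInt.hasSum_intervalIntegral_comp_add_int.tsum_eq]
    refine tsum_eq_sum fun n hn => ?_
    refine (intervalIntegral.integral_congr (g := fun _ => (0 : ℝ)) fun s hs => ?_).trans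
      intervalIntegral.integral_zero
    simp only
    rw [hg.apply_eq_zero hN fun h => hn (hA s hs n h), zero_mul]
  rw [h1, ← intervalIntegral.integral_finsetSum, integral_unitVol]
  · refine intervalIntegral.integral_congr fun s hs => ?_
    simp only [hφi]
    rw [hg.periodize_eq_sum hN (hA s hs), Finset.sum_mul]
  · exact fun n _ => Continuous.intervalIntegrable (by fun_prop) _ _

lemma integral_periodize (hg : Bump M Λ g) {N : ℝ} (hN : 1 ≤ N) :
    ∫ s, periodize g N s ∂unitVol = (∫ x, g x) / N := by
  have := hg.integral_periodize_mul hN (φ := fun _ => 1) continuous_const fun _ => rfl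
  simp only [mul_one] at this
  rw [this, Measure.integral_comp_mul_left, abs_of_nonneg (by positivity), smul_eq_mul]
  field_simp

end Bump

lemma ae_tendsto_of_integral_sq_le {Z : ℕ → ℝ → ℝ} {l C : ℝ}
    (h : ∀ᶠ m : ℕ in atTop, Continuous (Z m) ∧ ∫ α, (Z m α - l) ^ 2 ∂unitVol ≤ C / (m : ℝ) ^ 2) :
    ∀ᵐ α ∂unitVol, Tendsto (fun m => Z m α) atTop (nhds l) := by
  obtain ⟨m₀, hm₀⟩ := eventually_atTop.1 h
  have hc : ∀ m, Continuous fun α => (Z (m + m₀) α - l) ^ 2 := fun m => by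
    have := (hm₀ (m + m₀) (Nat.le_add_left _ _)).1
    fun_prop
  have hs : Summable fun m : ℕ => C / ((m + m₀ : ℕ) : ℝ) ^ 2 := by
    have : Summable fun m : ℕ => C * ((m : ℝ) ^ 2)⁻¹ :=
      (Real.summable_nat_pow_inv.2 one_lt_two).mul_left C
    exact (summable_nat_add_iff (f := fun m : ℕ => C * ((m : ℝ) ^ 2)⁻¹) m₀).2 this
  have hfin : ∫⁻ α, ∑' m : ℕ, ENNReal.ofReal ((Z (m + m₀) α - l) ^ 2) ∂unitVol ≠ ⊤ := by
    rw [lintegral_tsum fun m => ((hc _).measurable.ennreal_ofReal).aemeasurable]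
    refine ne_top_of_le_ne_top hs.tsum_ofReal_ne_top (ENNReal.tsum_le_tsum fun m => ?_)
    rw [← ofReal_integral_eq_lintegral_ofReal (integrable_unitVol (hc _))
      (Eventually.of_forall fun _ => sq_nonneg _)]
    exact ENNReal.ofReal_le_ofReal (hm₀ _ (Nat.le_add_left _ _)).2
  have hmeas : Measurable fun α => ∑' m : ℕ, ENNReal.ofReal ((Z (m + m₀) α - l) ^ 2) :=
    Measurable.tsum fun m => (hc _).measurable.ennreal_ofReal
  filter_upwards [ae_lt_top hmeas hfin] with α hα
  have h1 := (ENNReal.tendsto_toReal ENNReal.zero_ne_top).comp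
    (ENNReal.tendsto_atTop_zero_of_tsum_ne_top hα.ne)
  have h2 : Tendsto (fun m => (Z (m + m₀) α - l) ^ 2) atTop (nhds 0) := by
    refine h1.congr fun m => ?_
    simp [ENNReal.toReal_ofReal (sq_nonneg _)]
  have h3 : Tendsto (fun m => |Z (m + m₀) α - l|) atTop (nhds 0) := by
    simpa [Real.sqrt_sq_eq_abs] using h2.sqrt
  rw [← tendsto_add_atTop_iff_nat m₀, tendsto_iff_dist_tendsto_zero]
  simpa [Real.dist_eq] using h3

namespace PerLip

variable {B K B' K' : ℝ} {h : ℝ → ℝ}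

lemma mono (hh : PerLip B K h) (hB : B ≤ B') (hK : K ≤ K') : PerLip B' K' h where
  nonneg := hh.nonneg
  le x := (hh.le x).trans hB
  lip x y := (hh.lip x y).trans (mul_le_mul_of_nonneg_right hK (abs_nonneg _))
  per := hh.per

lemma sum {ι : Type*} (S : Finset ι) {G : ι → ℝ → ℝ} (hG : ∀ i, PerLip B K (G i)) :
    PerLip (S.card * B) (S.card * K) fun x => ∑ i ∈ S, G i x where
  nonneg x := Finset.sum_nonneg fun i _ => (hG i).nonneg x
  le x := by
    calc _ ≤ ∑ i ∈ S, B := Finset.sum_le_sum fun i _ => (hG i).le x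
      _ = _ := by simp
  lip x y := by
    rw [← Finset.sum_sub_distrib]
    calc _ ≤ ∑ i ∈ S, |G i x - G i y| := Finset.abs_sum_le_sum_abs _ _
      _ ≤ ∑ i ∈ S, K * |x - y| := Finset.sum_le_sum fun i _ => (hG i).lip x y
      _ = _ := by simp [mul_assoc]
  per x := Finset.sum_congr rfl fun i _ => (hG i).per x

end PerLip

lemma pow_mul_le_of_lacunary {a : ℕ → ℕ} {c : ℝ} (hc : 1 < c) (hlac : ∀ n, c * a n < a (n + 1))
    (L : ℕ) (y y' : ℕ) (h : y + L ≤ y') : c ^ L * a y ≤ a y' := by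
  have key : ∀ n, c ^ n * a y ≤ a (y + n) := by
    intro n
    induction n with
    | zero => simp
    | succ n ih =>
      have := hlac (y + n)
      rw [pow_succ', mul_assoc, ← add_assoc]
      exact (mul_le_mul_of_nonneg_left ih (by linarith)).trans this.le
  obtain ⟨n, rfl⟩ := Nat.exists_eq_add_of_le (show y ≤ y' by omega)
  refine le_trans ?_ (key n)
  gcongr
  · exact hc.le
  · omega

lemma strictMono_of_lacunary {a : ℕ → ℕ} {c : ℝ} (hc : 1 < c) (hlac : ∀ n, c * a n < a (n + 1)) :
    StrictMono a := by
  refine strictMono_nat_of_lt_succ fun n => ?_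
  have h := hlac n
  have h0 : (0 : ℝ) ≤ a n := Nat.cast_nonneg _
  have : (a n : ℝ) < a (n + 1) := by nlinarith
  exact_mod_cast this

lemma pow_div_pow_le_inv_sq {x : ℝ} (hx : 1 ≤ x) {i j : ℕ} (hij : i + 2 ≤ j) :
    x ^ i / x ^ j ≤ 1 / x ^ 2 := by
  have h0 : 0 < x := by linarith
  rw [div_le_div_iff₀ (by positivity) (by positivity), one_mul, ← pow_add]
  exact pow_le_pow_right₀ hx hij

lemma variance_bound_le {x P β E : ℝ} (hx : 1 ≤ x) (hP : 0 ≤ P) (hβ : 0 ≤ β) (hE : 0 ≤ E) (k : ℕ) :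
    (1 + 4 * k ^ 2 * x * P ^ 2 + 2 * P) / x ^ (8 * k + 8)
        + (2 * k) ^ 2 * (x ^ (4 * k + 4) * (2 * x * β ^ 2 / x ^ (8 * k + 8))
          + (1 + 2 * (2 * (β ^ (4 * k + 2) + 1) + (E * x) ^ (4 * k + 2))) / x ^ (4 * k + 4))
      ≤ ((1 + 4 * k ^ 2 * P ^ 2 + 2 * P) + (2 * k) ^ 2 * (2 * β ^ 2
          + (1 + 2 * (2 * (β ^ (4 * k + 2) + 1) + E ^ (4 * k + 2))))) / x ^ 2 := by
  have h0 : 0 < x := by linarith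
  have h1 : (1 + 4 * k ^ 2 * x * P ^ 2 + 2 * P) / x ^ (8 * k + 8)
      ≤ (1 + 4 * k ^ 2 * P ^ 2 + 2 * P) * (1 / x ^ 2) := by
    calc _ ≤ (1 * x + 4 * k ^ 2 * x * P ^ 2 + (2 * P) * x) / x ^ (8 * k + 8) := by
          refine div_le_div_of_nonneg_right ?_ (by positivity)
          have := le_mul_of_one_le_right (show 0 ≤ 2 * P by positivity) hx
          linarith
      _ = (1 + 4 * k ^ 2 * P ^ 2 + 2 * P) * (x ^ 1 / x ^ (8 * k + 8)) := by ring
      _ ≤ _ := by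
          gcongr ?_ * ?_
          exact pow_div_pow_le_inv_sq hx (by omega)
  have h2 : x ^ (4 * k + 4) * (2 * x * β ^ 2 / x ^ (8 * k + 8)) ≤ 2 * β ^ 2 * (1 / x ^ 2) := by
    calc _ = 2 * β ^ 2 * (x ^ (4 * k + 5) / x ^ (8 * k + 8)) := by
          rw [pow_succ x (4 * k + 4)]; ring
      _ ≤ _ := by
          gcongr ?_ * ?_
          exact pow_div_pow_le_inv_sq hx (by omega)
  have h3 : (1 + 2 * (2 * (β ^ (4 * k + 2) + 1) + (E * x) ^ (4 * k + 2))) / x ^ (4 * k + 4)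
      ≤ (1 + 2 * (2 * (β ^ (4 * k + 2) + 1) + E ^ (4 * k + 2))) * (1 / x ^ 2) := by
    have hq : 1 ≤ x ^ (4 * k + 2) := one_le_pow₀ hx
    calc _ ≤ (1 * x ^ (4 * k + 2) + 2 * (2 * (β ^ (4 * k + 2) + 1) * x ^ (4 * k + 2)
          + E ^ (4 * k + 2) * x ^ (4 * k + 2))) / x ^ (4 * k + 4) := by
          rw [mul_pow]
          refine div_le_div_of_nonneg_right ?_ (by positivity)
          have := le_mul_of_one_le_right (show 0 ≤ β ^ (4 * k + 2) + 1 by positivity) hq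
          linarith
      _ = (1 + 2 * (2 * (β ^ (4 * k + 2) + 1) + E ^ (4 * k + 2)))
          * (x ^ (4 * k + 2) / x ^ (4 * k + 4)) := by ring
      _ ≤ _ := by
          gcongr ?_ * ?_
          exact pow_div_pow_le_inv_sq hx le_rfl
  calc _ ≤ (1 + 4 * k ^ 2 * P ^ 2 + 2 * P) * (1 / x ^ 2) + (2 * k) ^ 2 * (2 * β ^ 2 * (1 / x ^ 2)
        + (1 + 2 * (2 * (β ^ (4 * k + 2) + 1) + E ^ (4 * k + 2))) * (1 / x ^ 2)) := by gcongr
    _ = _ := by ring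

/-- The smoothed correlation sum attached to the test functions `g i`, with `N` points. -/
noncomputable def smoothSum {k : ℕ} (a : ℕ → ℕ) (g : Fin k → ℝ → ℝ) (N : ℕ) (α : ℝ) : ℝ :=
  ∫ s, corrSum a (Finset.Icc 1 N) (fun i => periodize (g i) N) α s ∂unitVol

lemma ae_tendsto_smoothSum {c : ℝ} (hc : 1 < c) {a : ℕ → ℕ} (hpos : ∀ n, 0 < a n)
    (hlac : ∀ n, c * a n < a (n + 1)) {k : ℕ} {M Λ : ℝ} (hM : 0 ≤ M) {g : Fin k → ℝ → ℝ}
    (hg : ∀ i, Bump M Λ (g i)) :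
    ∀ᵐ α ∂unitVol, Tendsto (fun m : ℕ => smoothSum a g (m ^ (8 * k + 8)) α) atTop
      (nhds (∏ i, ∫ x, g i x)) := by
  wlog hΛ : 0 ≤ Λ
  · rcases isEmpty_or_nonempty (Fin k) with h | ⟨⟨i⟩⟩
    · exact this hc hpos hlac hM (Λ := 0) (fun i => h.elim i) le_rfl
    · exact absurd (hg i).lip_nonneg hΛ
  set B : ℝ := (k + 1) * (2 * M + 1) with hBdef
  have hB : 1 ≤ B := by
    have : (0 : ℝ) ≤ k := Nat.cast_nonneg k
    rw [hBdef]; nlinarith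
  set β : ℝ := ∑ i, ∫ x, g i x with hβdef
  have hβ0 : 0 ≤ β := Finset.sum_nonneg fun i _ => (hg i).integral_nonneg
  have hP0 : 0 ≤ ∏ i, ∫ x, g i x := Finset.prod_nonneg fun i _ => (hg i).integral_nonneg
  set D : ℝ := (k + 1) * (2 * (2 * M + 1) * Λ) with hDdef
  have hD : 0 ≤ D := by positivity
  have hev : ∀ᶠ m : ℕ in atTop, ((m : ℝ) ^ (8 * k + 8)) ^ (4 * k + 3)
      * ((4 * k + 2 : ℕ) ^ 2 * B ^ (4 * k + 2) * (D * (m : ℝ) ^ (8 * k + 8)) / c ^ m) ≤ 1 := by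
    have h := (tendsto_pow_const_div_const_pow_of_one_lt ((8 * k + 8) * (4 * k + 4)) hc).const_mul
      ((4 * k + 2 : ℕ) ^ 2 * B ^ (4 * k + 2) * D)
    rw [mul_zero] at h
    filter_upwards [h.eventually (gt_mem_nhds one_pos)] with m hm
    refine le_trans (le_of_eq ?_) hm.le
    rw [← pow_mul, mul_add (8 * k + 8) (4 * k) 4, mul_add (8 * k + 8) (4 * k) 3]
    ring
  refine ae_tendsto_of_integral_sq_le (C := (1 + 4 * k ^ 2 * (∏ i, ∫ x, g i x) ^ 2
      + 2 * ∏ i, ∫ x, g i x) + (2 * k) ^ 2 * (2 * β ^ 2 + (1 + 2 * (2 * (β ^ (4 * k + 2) + 1)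
      + (4 * (4 * k + 2 : ℕ) ^ 2 * B) ^ (4 * k + 2))))) ?_
  filter_upwards [hev, eventually_ge_atTop 1] with m hm hm1
  have hx : (1 : ℝ) ≤ m := by exact_mod_cast hm1
  have hN : (1 : ℝ) ≤ (m ^ (8 * k + 8) : ℕ) := by exact_mod_cast Nat.one_le_pow _ _ hm1
  set N : ℝ := ((m ^ (8 * k + 8) : ℕ) : ℝ) with hNdef
  have hNm : N = (m : ℝ) ^ (8 * k + 8) := by rw [hNdef]; push_cast; rfl
  have hG : ∀ i, PerLip (2 * M + 1) (2 * (2 * M + 1) * (Λ * N)) (periodize (g i) N) :=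
    fun i => (hg i).perLip hM hN
  refine ⟨?_, ?_⟩
  · have hGc : ∀ i, Continuous (periodize (g i) N) := fun i => (hG i).continuous
    change Continuous fun α =>
      ∫ s, corrSum a (Finset.Icc 1 (m ^ (8 * k + 8))) (fun i => periodize (g i) N) α s ∂unitVol
    simp only [integral_unitVol]
    exact intervalIntegral.continuous_parametric_intervalIntegral_of_continuous'
      (by simp only [Function.uncurry_def]; fun_prop) _ _
  have hk1 : (1 : ℝ) ≤ k + 1 := by linarith [Nat.cast_nonneg (α := ℝ) k]
  have hcard : ((Finset.Icc 1 (m ^ (8 * k + 8))).card : ℝ) = N := by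
    rw [Nat.card_Icc, Nat.add_sub_cancel]
  have hN0 : 0 ≤ N := by linarith
  have key := integral_sq_corrSum_sub_le (a := a) (L := m) (B := B) (K := D * N) (Q := c ^ m)
    hpos (strictMono_of_lacunary hc hlac) hm1 (pow_mul_le_of_lacunary hc hlac m) hB
    (by positivity) (by positivity) (Finset.Icc 1 (m ^ (8 * k + 8)))
    (by rw [Nat.card_Icc, Nat.add_sub_cancel]; exact Nat.one_le_pow _ _ hm1)
    (G := fun i => periodize (g i) N) (fun i => (hG i).mono
      (by rw [hBdef]; exact le_mul_of_one_le_left (by positivity) hk1)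
      (by
        rw [hDdef]
        calc _ = 1 * (2 * (2 * M + 1) * Λ) * N := by ring
          _ ≤ _ := by gcongr))
    (μ := fun i => ∫ x, g i x) (fun i => by rw [hcard]; exact (hg i).integral_periodize hN)
    (by rw [hcard, hNm]; exact hm)
    (W := fun x => ∑ i, periodize (g i) N x)
    ((PerLip.sum Finset.univ hG).mono
      (by
        rw [hBdef, Finset.card_univ, Fintype.card_fin]
        gcongr
        linarith)
      (by
        rw [hDdef, Finset.card_univ, Fintype.card_fin]
        calc _ = k * (2 * (2 * M + 1) * Λ) * N := by ring
          _ ≤ _ := by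
            gcongr
            linarith))
    (fun i x => Finset.single_le_sum (f := fun i => periodize (g i) N x)
      (fun i _ => (hG i).nonneg x) (Finset.mem_univ i))
    (β := β)
    (by
      rw [integral_finsetSum _ fun i _ => integrable_unitVol (hG i).continuous, hcard, hβdef,
        Finset.sum_div]
      exact Finset.sum_congr rfl fun i _ => (hg i).integral_periodize hN)
    (lam := (m : ℝ) ^ (4 * k + 4)) (by positivity)
  rw [hcard] at key
  have key2 := variance_bound_le (E := 4 * (4 * k + 2 : ℕ) ^ 2 * B) hx hP0 hβ0 (by positivity) k
  rw [← hNm, mul_right_comm _ B (m : ℝ)] at key2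
  exact key.trans key2

lemma Fin.partialSum_sub {G : Type*} [AddCommGroup G] {n : ℕ} (d : Fin (n + 1) → G)
    (j : Fin (n + 1)) :
    Fin.partialSum (fun i : Fin n => d i.castSucc - d i.succ) j = d 0 - d j := by
  induction j using Fin.induction with
  | zero => simp
  | succ i ih => rw [Fin.partialSum_succ, ih]; abel

/-- A tuple of integers is determined by its negated nontrivial partial sums. -/
noncomputable def negPartialSumEquiv (n : ℕ) : (Fin n → ℤ) ≃ (Fin n → ℤ) where
  toFun m i := -Fin.partialSum m i.succ
  invFun e i := (Fin.cons 0 e : Fin (n + 1) → ℤ) i.castSucc - (Fin.cons 0 e : Fin (n + 1) → ℤ) i.succ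
  left_inv m := by
    have h : (Fin.cons 0 fun i => -Fin.partialSum m i.succ : Fin (n + 1) → ℤ)
        = fun j => -Fin.partialSum m j := by
      ext j; cases j using Fin.cases <;> simp
    ext i
    simp only [h]
    rw [Fin.partialSum_succ]; ring
  right_inv e := by
    ext i
    simp only [Fin.partialSum_sub]; simp

/-- The point of `ℝ^(n+1)` with first coordinate `s` and consecutive differences `y`. -/
noncomputable def ofDiffs {n : ℕ} (s : ℝ) (y : Fin n → ℝ) : Fin (n + 1) → ℝ :=
  fun i => s - Fin.partialSum y i

/-- Integration of `∏ i, g i` along the diagonal direction. -/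
noncomputable def convProd {n : ℕ} (g : Fin (n + 1) → ℝ → ℝ) (y : Fin n → ℝ) : ℝ :=
  ∫ s, ∏ i, g i (ofDiffs s y i)

lemma tsum_convProd {n : ℕ} {M Λ : ℝ} (hM : 0 ≤ M) {g : Fin (n + 1) → ℝ → ℝ}
    (hg : ∀ i, Bump M Λ (g i)) {N : ℝ} (hN : 1 ≤ N) (θ : Fin (n + 1) → ℝ) :
    ∑' m : Fin n → ℤ, convProd g (fun i => N * (m i + (θ i.castSucc - θ i.succ)))
      = N * ∫ s, ∏ i, periodize (g i) N (θ i + s) ∂unitVol := by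
  have hN0 : 0 < N := by linarith
  set δ : Fin n → ℝ := fun i => θ i.succ - θ 0 with hδ
  set F : (Fin n → ℤ) → ℝ := fun e => ∫ s, g 0 s * ∏ i : Fin n, g i.succ (s + N * (δ i + e i)) with hF
  have hgc := fun i => (hg i).continuous
  have hpl := fun i => (hg i).perLip hM hN
  have hlhs : ∀ m : Fin n → ℤ, convProd g (fun i => N * (m i + (θ i.castSucc - θ i.succ)))
      = F (negPartialSumEquiv n m) := by
    intro m
    have hps : ∀ j, Fin.partialSum (fun i => N * ((m i : ℝ) + (θ i.castSucc - θ i.succ))) j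
        = N * ((Fin.partialSum m j : ℤ) + (θ 0 - θ j)) := by
      intro j
      induction j using Fin.induction with
      | zero => simp
      | succ i ih => rw [Fin.partialSum_succ, Fin.partialSum_succ, ih]; push_cast; ring
    simp only [hF, convProd, ofDiffs, hps]
    congr 1; ext s
    rw [Fin.prod_univ_succ]
    congr 1
    · simp
    · refine Finset.prod_congr rfl fun i _ => ?_
      congr 1
      simp only [negPartialSumEquiv, Equiv.coe_fn_mk, hδ]; push_cast; ring
  simp only [hlhs]
  rw [(negPartialSumEquiv n).tsum_eq F]
  set E : Finset (Fin n → ℤ) := Fintype.piFinset fun i => intsNear (2 * M) (δ i) with hE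
  have hF0 : ∀ e ∉ E, F e = 0 := by
    intro e he
    simp only [hE, Fintype.mem_piFinset, not_forall, mem_intsNear] at he
    obtain ⟨i, hi⟩ := he
    rw [hF]
    refine (integral_congr_ae (Eventually.of_forall fun s => ?_)).trans (integral_zero ℝ ℝ)
    by_cases hs : |s| ≤ M
    · rw [Finset.prod_eq_zero (Finset.mem_univ i), mul_zero]
      apply (hg _).supp
      push Not at hi
      have h1 : 2 * M < |N * (δ i + e i)| := by
        rw [abs_mul, abs_of_pos hN0]; nlinarith [abs_nonneg (δ i + e i)]
      have h2 := abs_sub_abs_le_abs_sub (N * (δ i + e i)) (-s)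
      rw [abs_neg, sub_neg_eq_add, add_comm _ s] at h2
      linarith
    · rw [(hg 0).supp s (not_le.1 hs), zero_mul]
  rw [tsum_eq_sum hF0]
  have hper : Function.Periodic (fun s => ∏ i : Fin n, periodize (g i.succ) N (δ i + s)) 1 := by
    intro s
    refine Finset.prod_congr rfl fun i _ => ?_
    rw [← add_assoc]; exact (hpl _).per _
  have hpc : ∀ i, Continuous (periodize (g i) N) := fun i => (hpl i).continuous
  have hprodper : Function.Periodic (fun s => ∏ i, periodize (g i) N (θ i + s)) 1 := by
    intro s
    refine Finset.prod_congr rfl fun i _ => ?_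
    rw [← add_assoc]; exact (hpl _).per _
  have hrhs : ∫ s, ∏ i, periodize (g i) N (θ i + s) ∂unitVol
      = ∫ s, g 0 (N * s) * ∏ i : Fin n, periodize (g i.succ) N (δ i + s) := by
    rw [← (hg 0).integral_periodize_mul hN (by fun_prop) hper, ← integral_unitVol_add hprodper (-θ 0)]
    congr 1; ext s
    rw [Fin.prod_univ_succ]
    congr 1
    · congr 1; ring
    · refine Finset.prod_congr rfl fun i _ => ?_
      congr 1; simp only [hδ]; ring
  have hscale := Measure.integral_comp_mul_left
    (fun s => g 0 s * ∏ i : Fin n, periodize (g i.succ) N (δ i + s / N)) N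
  simp only [mul_div_cancel_left₀ _ hN0.ne', abs_of_pos (inv_pos.2 hN0), smul_eq_mul] at hscale
  rw [hrhs, hscale, mul_inv_cancel_left₀ hN0.ne', hF, ← integral_finsetSum]
  · congr 1; ext s
    by_cases hs : |s| ≤ M
    · rw [← Finset.mul_sum]
      congr 1
      have hloc : ∀ i : Fin n, periodize (g i.succ) N (δ i + s / N)
          = ∑ e ∈ intsNear (2 * M) (δ i), g i.succ (s + N * (δ i + e)) := by
        intro i
        rw [(hg i.succ).periodize_eq_sum hN (s := intsNear (2 * M) (δ i))]
        · refine Finset.sum_congr rfl fun e _ => ?_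
          congr 1; field_simp; ring
        · intro e he
          rw [mem_intsNear]
          have h1 : |s / N| ≤ M := by
            rw [abs_div, abs_of_pos hN0]
            exact (div_le_self (abs_nonneg _) hN).trans hs
          rw [abs_le] at *
          constructor <;> linarith [h1.1, h1.2, he.1, he.2]
      simp only [hloc]
      rw [Finset.prod_univ_sum]
    · simp [(hg 0).supp s (not_le.1 hs)]
  · intro e _
    refine Continuous.integrable_of_hasCompactSupport (by fun_prop) ?_
    exact (hg 0).hasCompactSupport.mul_right

/-- Reformulation of the correlation sums with the level shifted by one. -/
noncomputable def corrAvg (a : ℕ → ℕ) (n : ℕ) (f : (Fin n → ℝ) → ℝ) (N : ℕ) (α : ℝ) : ℝ :=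
  (1 / (N : ℝ)) * ∑ x ∈ injTuples (n + 1) (Finset.Icc 1 N), ∑' m : Fin n → ℤ,
    f fun i => (N : ℝ) * (m i + α * ((a (x i.castSucc) : ℝ) - a (x i.succ)))

lemma corrAvg_convProd {n : ℕ} {M Λ : ℝ} (hM : 0 ≤ M) {g : Fin (n + 1) → ℝ → ℝ}
    (hg : ∀ i, Bump M Λ (g i)) (a : ℕ → ℕ) {N : ℕ} (hN : 1 ≤ N) (α : ℝ) :
    corrAvg a n (convProd g) N α = smoothSum a g N α := by
  have hN' : (1 : ℝ) ≤ N := by exact_mod_cast hN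
  have hpc : ∀ i, Continuous (periodize (g i) N) := fun i => ((hg i).perLip hM hN').continuous
  have h1 : ∀ x : Fin (n + 1) → ℕ, ∑' m : Fin n → ℤ,
      convProd g (fun i => (N : ℝ) * (m i + α * ((a (x i.castSucc) : ℝ) - a (x i.succ))))
      = N * ∫ s, ∏ i, periodize (g i) N (α * a (x i) + s) ∂unitVol := by
    intro x
    rw [← tsum_convProd hM hg hN' fun i => α * a (x i)]
    simp only [mul_sub]
  rw [corrAvg, smoothSum]
  simp only [h1]
  rw [← Finset.mul_sum, ← mul_assoc, one_div, inv_mul_cancel₀ (by linarith), one_mul,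
    ← integral_finsetSum]
  · rfl
  · intro x _
    exact integrable_unitVol (by fun_prop)

@[simp] lemma ofDiffs_zero {n : ℕ} (s : ℝ) (y : Fin n → ℝ) : ofDiffs s y 0 = s := by simp [ofDiffs]

lemma ofDiffs_sub {n : ℕ} (s : ℝ) (y : Fin n → ℝ) (i : Fin n) :
    ofDiffs s y i.castSucc - ofDiffs s y i.succ = y i := by
  simp only [ofDiffs, Fin.partialSum_succ]; ring

lemma continuous_ofDiffs {n : ℕ} (y : Fin n → ℝ) : Continuous fun s => ofDiffs s y := by
  unfold ofDiffs; fun_prop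

/-- The matrix of the map `ofDiffs`. -/
def diffMatrix (n : ℕ) : Matrix (Fin (n + 1)) (Fin (n + 1)) ℝ :=
  Matrix.of fun i j => if j = 0 then 1 else if j ≤ i then -1 else 0

lemma diffMatrix_mulVec_cons {n : ℕ} (s : ℝ) (y : Fin n → ℝ) :
    (diffMatrix n).mulVec (Fin.cons s y : Fin (n + 1) → ℝ) = ofDiffs s y := by
  ext i
  have h : ∀ i : Fin (n + 1), ∑ j : Fin n, (if j.succ ≤ i then (-1 : ℝ) else 0) * y j
      = -Fin.partialSum y i := by
    intro i
    induction i using Fin.induction with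
    | zero => simp
    | succ i ih =>
      rw [Fin.partialSum_succ, neg_add, ← ih, ← sub_eq_iff_eq_add', ← Finset.sum_sub_distrib,
        Finset.sum_eq_single i]
      · simp
      · intro j _ hj
        have : j.succ ≤ i.succ ↔ j.succ ≤ i.castSucc := by
          rw [Fin.succ_le_succ_iff, Fin.succ_le_castSucc_iff]
          exact ⟨fun h => lt_of_le_of_ne h hj, le_of_lt⟩
        simp [this]
      · simp
  rw [Matrix.mulVec, dotProduct, Fin.sum_univ_succ]
  simp [diffMatrix, Fin.succ_ne_zero, ← h, ofDiffs, sub_eq_add_neg]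

lemma abs_det_diffMatrix (n : ℕ) : |(diffMatrix n).det| = 1 := by
  rw [Matrix.det_of_isLowerTriangular, Finset.abs_prod]
  · refine Finset.prod_eq_one fun i _ => ?_
    by_cases h : i = 0 <;> simp [diffMatrix, h]
  · intro i j hij
    have hij' : i < j := hij
    have h0 : j ≠ 0 := fun h => by simp [h] at hij'
    simp [diffMatrix, h0, not_le.2 hij']

lemma measurePreserving_ofDiffs (n : ℕ) :
    MeasurePreserving fun p : ℝ × (Fin n → ℝ) => ofDiffs p.1 p.2 := by
  have h1 : MeasurePreserving (Matrix.toLin' (diffMatrix n)) := by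
    refine ⟨(LinearMap.continuous_of_finiteDimensional _).measurable, ?_⟩
    have hd := abs_det_diffMatrix n
    rw [Real.map_matrix_volume_pi_eq_smul_volume_pi (fun h => by simp [h] at hd), abs_inv, hd]
    simp
  have h2 := (volume_preserving_piFinSuccAbove (fun _ : Fin (n + 1) => ℝ) 0).symm
  convert h1.comp h2 using 1
  ext1 p
  rw [← diffMatrix_mulVec_cons]
  simp [MeasurableEquiv.piFinSuccAbove, Fin.insertNthEquiv, Fin.insertNth_zero']

section diagonal

variable {n : ℕ} {H : (Fin (n + 1) → ℝ) → ℝ} {M : ℝ}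

lemma hasCompactSupport_of_abs (h0 : ∀ z i, M < |z i| → H z = 0) : HasCompactSupport H := by
  refine HasCompactSupport.intro (isCompact_univ_pi fun _ : Fin (n + 1) => isCompact_Icc (a := -M) (b := M))
    fun z hz => ?_
  simp only [Set.mem_univ_pi, not_forall] at hz
  obtain ⟨i, hi⟩ := hz
  exact h0 z i (not_le.1 fun h => hi (abs_le.1 h))

lemma integrable_diag (hc : Continuous H) (h0 : ∀ z i, M < |z i| → H z = 0) (y : Fin n → ℝ) :
    Integrable fun s => H (ofDiffs s y) := by
  refine (hc.comp (continuous_ofDiffs y)).integrable_of_hasCompactSupport ?_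
  refine HasCompactSupport.intro (isCompact_Icc (a := -M) (b := M)) fun s hs => h0 _ 0 ?_
  simp only [ofDiffs_zero]
  exact not_le.1 fun h => hs (abs_le.1 h)

lemma integral_diag_eq_zero (h0 : ∀ z i, M < |z i| → H z = 0) (y : Fin n → ℝ) (hM : 0 ≤ M)
    (hy : 2 * M < ‖y‖) : ∫ s, H (ofDiffs s y) = 0 := by
  have : ∃ i, 2 * M < |y i| := by
    by_contra! h
    exact absurd ((pi_norm_le_iff_of_nonneg (by linarith)).2 h) (not_le.2 hy)
  obtain ⟨i, hi⟩ := this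
  refine (integral_congr_ae (Eventually.of_forall fun s => ?_)).trans (integral_zero ℝ ℝ)
  rw [← ofDiffs_sub s y i] at hi
  by_contra hne
  have h1 := not_lt.1 (mt (h0 (ofDiffs s y) i.castSucc) hne)
  have h2 := not_lt.1 (mt (h0 (ofDiffs s y) i.succ) hne)
  have := abs_sub (ofDiffs s y i.castSucc) (ofDiffs s y i.succ)
  linarith

lemma integrable_integral_diag (hc : Continuous H) (h0 : ∀ z i, M < |z i| → H z = 0) :
    Integrable fun y : Fin n → ℝ => ∫ s, H (ofDiffs s y) :=
  ((measurePreserving_ofDiffs n).integrable_comp_of_integrable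
    (hc.integrable_of_hasCompactSupport (hasCompactSupport_of_abs h0))).integral_prod_right

lemma integral_integral_diag (hc : Continuous H) (h0 : ∀ z i, M < |z i| → H z = 0) :
    ∫ y : Fin n → ℝ, ∫ s, H (ofDiffs s y) = ∫ z, H z := by
  have hi := hc.integrable_of_hasCompactSupport (μ := volume) (hasCompactSupport_of_abs h0)
  have hi' := (measurePreserving_ofDiffs n).integrable_comp_of_integrable hi
  refine (integral_prod_symm _ hi').symm.trans ?_
  have hmp := measurePreserving_ofDiffs n
  conv_rhs => rw [← hmp.map_eq]
  rw [integral_map hmp.measurable.aemeasurable (by rw [hmp.map_eq]; exact hi.aestronglyMeasurable)]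
  rfl

end diagonal

lemma Bump.mono {M M' Λ Λ' : ℝ} {g : ℝ → ℝ} (hg : Bump M Λ g) (hM : M ≤ M') (hΛ : Λ ≤ Λ') :
    Bump M' Λ' g where
  nonneg := hg.nonneg
  le_one := hg.le_one
  lip x y := (hg.lip x y).trans (mul_le_mul_of_nonneg_right hΛ (abs_nonneg _))
  supp x hx := hg.supp x (hM.trans_lt hx)

/-- The triangle function. -/
noncomputable def tent (x : ℝ) : ℝ := max 0 (1 - |x|)

lemma tent_eq_zero {x : ℝ} (hx : 1 ≤ |x|) : tent x = 0 := max_eq_left (by linarith)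

lemma tent_eq {x : ℝ} (hx : |x| ≤ 1) : tent x = 1 - |x| := max_eq_right (by linarith)

lemma abs_tent_sub_le (x y : ℝ) : |tent x - tent y| ≤ |x - y| := by
  unfold tent
  refine (abs_max_sub_max_le_max _ _ _ _).trans ?_
  rw [sub_self, abs_zero, max_eq_right (abs_nonneg _), sub_sub_sub_cancel_left, abs_sub_comm x y]
  exact abs_abs_sub_abs_le _ _

lemma bump_tent (r : ℕ) (hr : 0 < r) (j : ℤ) : Bump (1 + |(j : ℝ)|) r fun z => tent (r * z - j) where
  nonneg z := le_max_left _ _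
  le_one z := max_le zero_le_one (by linarith [abs_nonneg (r * z - j)])
  lip x y := (abs_tent_sub_le _ _).trans <| by
    rw [sub_sub_sub_cancel_right, ← mul_sub, abs_mul, Nat.abs_cast]
  supp z hz := tent_eq_zero <| by
    have h1 : (1 : ℝ) ≤ r := by exact_mod_cast hr
    have h2 := abs_sub_abs_le_abs_sub (r * z) (j : ℝ)
    rw [abs_mul, Nat.abs_cast] at h2
    nlinarith [abs_nonneg z]

lemma continuous_tent : Continuous tent := by unfold tent; fun_prop

lemma sum_tent_eq_one {L : ℤ} {x : ℝ} (hx : |x| ≤ L) :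
    ∑ j ∈ Finset.Icc (-L) L, tent (x - j) = 1 := by
  obtain ⟨h1, h2⟩ := abs_le.1 hx
  have hf := Int.floor_le x
  have hf' := Int.lt_floor_add_one x
  have e1 : ∑ j ∈ Finset.Icc (-L) L, tent (x - j) = ∑ j ∈ Finset.Icc (-L) (L + 1), tent (x - j) := by
    refine Finset.sum_subset (Finset.Icc_subset_Icc le_rfl (by omega)) fun j hj hj' => ?_
    rw [Finset.mem_Icc] at hj hj'
    have : j = L + 1 := by omega
    subst this
    apply tent_eq_zero
    rw [le_abs]; right; push_cast; linarith
  have e2 : ∑ j ∈ Finset.Icc (-L) (L + 1), tent (x - j) = ∑ j ∈ {⌊x⌋, ⌊x⌋ + 1}, tent (x - j) := by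
    symm
    have hl : -L ≤ ⌊x⌋ := Int.le_floor.2 (by push_cast; exact h1)
    have hu : ⌊x⌋ ≤ L := by
      have : (⌊x⌋ : ℝ) ≤ L := by linarith
      exact_mod_cast this
    refine Finset.sum_subset (fun j hj => ?_) fun j _ hj => ?_
    · simp only [Finset.mem_insert, Finset.mem_singleton] at hj
      rw [Finset.mem_Icc]; omega
    · simp only [Finset.mem_insert, Finset.mem_singleton, not_or] at hj
      apply tent_eq_zero
      rw [le_abs]
      rcases lt_or_gt_of_ne hj.1 with h | h
      · left
        have : (j : ℝ) + 1 ≤ ⌊x⌋ := by exact_mod_cast h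
        linarith
      · right
        have : (⌊x⌋ : ℝ) + 2 ≤ j := by
          have : ⌊x⌋ + 2 ≤ j := by omega
          exact_mod_cast this
        linarith
  rw [e1, e2, Finset.sum_pair (by omega), tent_eq, tent_eq, abs_of_nonneg (by linarith),
    abs_of_nonpos (by push_cast; linarith)]
  · push_cast; ring
  · rw [abs_le]; push_cast; constructor <;> linarith
  · rw [abs_le]; constructor <;> linarith

/-- Grid points indexing the tents of width `1 / r` that meet the box `[-R, R]^(n+1)`. -/
noncomputable def gridBox (n r R : ℕ) : Finset (Fin (n + 1) → ℤ) :=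
  Fintype.piFinset fun _ => Finset.Icc (-((r * R : ℕ) : ℤ)) ((r * R : ℕ) : ℤ)

/-- A product of tents of width `1 / r` centred at `j / r`. -/
noncomputable def tents {n : ℕ} (r : ℕ) (j : Fin (n + 1) → ℤ) (i : Fin (n + 1)) (z : ℝ) : ℝ :=
  tent (r * z - j i)

lemma exists_bump_tents {n r : ℕ} (hr : 0 < r) (j : Fin (n + 1) → ℤ) :
    ∃ M : ℝ, 0 ≤ M ∧ ∀ i, Bump M r (tents r j i) := by
  refine ⟨∑ i, (1 + |(j i : ℝ)|), Finset.sum_nonneg fun i _ => by positivity, fun i => ?_⟩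
  exact (bump_tent r hr (j i)).mono
    (Finset.single_le_sum (f := fun i => 1 + |(j i : ℝ)|) (fun i _ => by positivity)
      (Finset.mem_univ i)) le_rfl

lemma exists_tents_approx {n R : ℕ} {H : (Fin (n + 1) → ℝ) → ℝ} (hc : Continuous H)
    (h0 : ∀ z i, (R : ℝ) < |z i| → H z = 0) {ε : ℝ} (hε : 0 < ε) :
    ∃ r : ℕ, 0 < r ∧ ∃ b : (Fin (n + 1) → ℤ) → ℝ, ∀ z,
      |H z - ∑ j ∈ gridBox n r R, b j * ∏ i, tents r j i (z i)|
        ≤ ε * ∑ j ∈ gridBox n r R, ∏ i, tents r j i (z i) := by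
  have huc := (hasCompactSupport_of_abs h0).uniformContinuous_of_continuous hc
  obtain ⟨δ, hδ, hH⟩ := Metric.uniformContinuous_iff.1 huc ε hε
  obtain ⟨r', hr'⟩ := exists_nat_one_div_lt hδ
  set r := r' + 1
  have hr0 : (0 : ℝ) < r := by positivity
  have hrδ : 1 / (r : ℝ) < δ := by simpa [r] using hr'
  refine ⟨r, by positivity, fun j => H fun i => j i / r, fun z => ?_⟩
  have hpart : H z = ∑ j ∈ gridBox n r R, H z * ∏ i, tents r j i (z i) := by
    rw [← Finset.mul_sum]
    by_cases hz : ∃ i, (R : ℝ) < |z i|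
    · obtain ⟨i, hi⟩ := hz
      rw [h0 z i hi, zero_mul]
    · push Not at hz
      unfold gridBox tents
      rw [← Finset.prod_univ_sum _ fun i (e : ℤ) => tent (r * z i - e), Finset.prod_eq_one, mul_one]
      intro i _
      apply sum_tent_eq_one
      rw [abs_mul, Nat.abs_cast]
      push_cast
      exact mul_le_mul_of_nonneg_left (hz i) hr0.le
  nth_rewrite 1 [hpart]
  rw [← Finset.sum_sub_distrib, Finset.mul_sum]
  refine (Finset.abs_sum_le_sum_abs _ _).trans (Finset.sum_le_sum fun j _ => ?_)
  have hnn : 0 ≤ ∏ i, tents r j i (z i) := Finset.prod_nonneg fun i _ => le_max_left _ _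
  rw [← sub_mul, abs_mul, abs_of_nonneg hnn]
  by_cases hne : ∏ i, tents r j i (z i) = 0
  · rw [hne]; simp
  · refine mul_le_mul_of_nonneg_right (le_of_lt ?_) hnn
    rw [← Real.dist_eq]
    refine hH ((dist_pi_lt_iff hδ).2 fun i => ?_)
    have hi := Finset.prod_ne_zero_iff.1 hne i (Finset.mem_univ i)
    have hlt : |r * z i - j i| < 1 := not_le.1 fun h => hi (tent_eq_zero h)
    have : z i - j i / r = (r * z i - j i) / r := by field_simp
    rw [Real.dist_eq, this, abs_div, abs_of_pos hr0]
    exact (div_lt_div_of_pos_right hlt hr0).trans hrδ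

lemma integral_tents {n r : ℕ} (hr : 0 < r) (j : Fin (n + 1) → ℤ) (i : Fin (n + 1)) :
    ∫ z, tents r j i z = (∫ x, tent x) / r := by
  have h1 := Measure.integral_comp_mul_left (fun x => tent (x - j i)) (r : ℝ)
  rw [integral_sub_right_eq_self, abs_of_pos (by positivity), smul_eq_mul] at h1
  unfold tents
  rw [h1]; ring

lemma sum_prod_integral_tents_le {n r : ℕ} (R : ℕ) (hr : 0 < r) :
    ∑ j ∈ gridBox n r R, ∏ i, ∫ z, tents r j i z ≤ ((2 * R + 1) * ∫ x, tent x) ^ (n + 1) := by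
  have hr1 : (1 : ℝ) ≤ r := by exact_mod_cast hr
  have hC : 0 ≤ ∫ x, tent x := integral_nonneg fun x => le_max_left _ _
  simp only [integral_tents hr]
  have hcard : ((gridBox n r R).card : ℝ) = (2 * (r * R) + 1) ^ (n + 1) := by
    rw [gridBox, Fintype.card_piFinset_const, Int.card_Icc]
    push_cast
    congr 1
    have : ((r * R : ℤ) + 1 - -(r * R : ℤ)).toNat = 2 * (r * R) + 1 := by
      rw [← Nat.cast_mul]; omega
    rw [this]; push_cast; ring
  rw [Finset.sum_const, Finset.prod_const, nsmul_eq_mul, hcard, Finset.card_univ, Fintype.card_fin,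
    ← mul_pow]
  have hR : (0 : ℝ) ≤ R := Nat.cast_nonneg R
  refine pow_le_pow_left₀ (by positivity) ?_ _
  rw [mul_div_assoc', div_le_iff₀ (by linarith)]
  have : (2 * (r * R) + 1 : ℝ) ≤ (2 * R + 1) * r := by nlinarith
  nlinarith [mul_le_mul_of_nonneg_right this hC]

/-- `f` vanishes outside of some ball around the origin. -/
def VanishesFar {E : Type*} [Norm E] (f : E → ℝ) : Prop := ∃ R : ℝ, ∀ y, R < ‖y‖ → f y = 0

lemma HasCompactSupport.vanishesFar {n : ℕ} {f : (Fin n → ℝ) → ℝ} (hf : HasCompactSupport f) :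
    VanishesFar f := by
  obtain ⟨R, hR⟩ := hf.isCompact.isBounded.subset_closedBall 0
  refine ⟨R, fun y hy => image_eq_zero_of_notMem_tsupport fun h => ?_⟩
  have := hR h
  rw [mem_closedBall_zero_iff] at this
  linarith

lemma VanishesFar.sum_mul {n : ℕ} {ι : Type*} {J : Finset ι} (b : ι → ℝ) {G : ι → (Fin n → ℝ) → ℝ}
    (hG : ∀ j ∈ J, VanishesFar (G j)) : VanishesFar fun y => ∑ j ∈ J, b j * G j y := by
  choose! R hR using hG
  refine ⟨∑ j ∈ J, |R j|, fun y hy => Finset.sum_eq_zero fun j hj => ?_⟩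
  rw [hR j hj y, mul_zero]
  calc R j ≤ |R j| := le_abs_self _
    _ ≤ ∑ j ∈ J, |R j| := Finset.single_le_sum (f := fun j => |R j|) (fun _ _ => abs_nonneg _) hj
    _ < _ := hy

lemma VanishesFar.summable {n : ℕ} {f : (Fin n → ℝ) → ℝ} (hf : VanishesFar f) {t : ℝ} (ht : 1 ≤ t)
    (δ : Fin n → ℝ) : Summable fun m : Fin n → ℤ => f fun i => t * (m i + δ i) := by
  obtain ⟨R, hR⟩ := hf
  refine summable_of_ne_finset_zero (s := Fintype.piFinset fun i => intsNear R (δ i)) fun m hm => ?_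
  simp only [Fintype.mem_piFinset, not_forall, mem_intsNear, not_le] at hm
  obtain ⟨i, hi⟩ := hm
  refine hR _ (lt_of_lt_of_le ?_ (norm_le_pi_norm _ i))
  rw [Real.norm_eq_abs, abs_mul, abs_of_nonneg (by linarith), add_comm]
  nlinarith [abs_nonneg (δ i + m i)]

section corrAvg

variable {a : ℕ → ℕ} {n N : ℕ} {α : ℝ}

lemma corrAvg_mono {f g : (Fin n → ℝ) → ℝ} (hf : VanishesFar f) (hg : VanishesFar g)
    (hfg : ∀ y, f y ≤ g y) (hN : 1 ≤ N) : corrAvg a n f N α ≤ corrAvg a n g N α := by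
  have hN' : (1 : ℝ) ≤ N := by exact_mod_cast hN
  refine mul_le_mul_of_nonneg_left (Finset.sum_le_sum fun x _ => ?_) (by positivity)
  exact (hf.summable hN' _).tsum_le_tsum (fun m => hfg _) (hg.summable hN' _)

lemma corrAvg_sum_mul {ι : Type*} {J : Finset ι} (b : ι → ℝ) {G : ι → (Fin n → ℝ) → ℝ}
    (hG : ∀ j ∈ J, VanishesFar (G j)) (hN : 1 ≤ N) :
    corrAvg a n (fun y => ∑ j ∈ J, b j * G j y) N α = ∑ j ∈ J, b j * corrAvg a n (G j) N α := by
  have hN' : (1 : ℝ) ≤ N := by exact_mod_cast hN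
  have h : ∀ x : Fin (n + 1) → ℕ, ∑' m : Fin n → ℤ, ∑ j ∈ J,
      b j * G j (fun i => (N : ℝ) * (m i + α * ((a (x i.castSucc) : ℝ) - a (x i.succ))))
      = ∑ j ∈ J, b j * ∑' m : Fin n → ℤ,
        G j (fun i => (N : ℝ) * (m i + α * ((a (x i.castSucc) : ℝ) - a (x i.succ)))) := by
    intro x
    rw [Summable.tsum_finsetSum fun j hj => ((hG j hj).summable hN' _).mul_left _]
    exact Finset.sum_congr rfl fun j _ => tsum_mul_left
  simp only [corrAvg, h]
  rw [Finset.sum_comm, Finset.mul_sum]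
  refine Finset.sum_congr rfl fun j _ => ?_
  rw [← Finset.mul_sum]; ring

lemma corrAvg_add_mul {f g : (Fin n → ℝ) → ℝ} (hf : VanishesFar f) (hg : VanishesFar g) (t : ℝ)
    (hN : 1 ≤ N) : corrAvg a n (fun y => f y + t * g y) N α
      = corrAvg a n f N α + t * corrAvg a n g N α := by
  have := corrAvg_sum_mul (a := a) (α := α) (J := Finset.univ) ![1, t] (G := ![f, g])
    (by simp [Fin.forall_fin_two, hf, hg]) hN
  simpa [Fin.sum_univ_two] using this

end corrAvg

section subsequence

variable {n : ℕ}

lemma prod_tents_eq_zero {r : ℕ} (hr : 0 < r) (j : Fin (n + 1) → ℤ) :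
    ∃ M : ℝ, 0 ≤ M ∧ ∀ (z : Fin (n + 1) → ℝ) (i : Fin (n + 1)), M < |z i| →
      ∏ i, tents r j i (z i) = 0 := by
  obtain ⟨M, hM, hb⟩ := exists_bump_tents hr j
  exact ⟨M, hM, fun z i hi => Finset.prod_eq_zero (Finset.mem_univ i) ((hb i).supp _ hi)⟩

lemma continuous_prod_tents (r : ℕ) (j : Fin (n + 1) → ℤ) :
    Continuous fun z : Fin (n + 1) → ℝ => ∏ i, tents r j i (z i) := by
  have := continuous_tent
  unfold tents; fun_prop

lemma integral_convProd_tents {r : ℕ} (hr : 0 < r) (j : Fin (n + 1) → ℤ) :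
    ∫ y : Fin n → ℝ, convProd (tents r j) y = ∏ i, ∫ z, tents r j i z := by
  obtain ⟨M, hM, h0⟩ := prod_tents_eq_zero hr j
  unfold convProd
  rw [integral_integral_diag (H := fun z => ∏ i, tents r j i (z i)) (continuous_prod_tents r j) h0,
    integral_fintype_prod_volume_eq_prod]

lemma integrable_convProd_tents {r : ℕ} (hr : 0 < r) (j : Fin (n + 1) → ℤ) :
    Integrable fun y : Fin n → ℝ => convProd (tents r j) y := by
  obtain ⟨M, hM, h0⟩ := prod_tents_eq_zero hr j
  exact integrable_integral_diag (H := fun z => ∏ i, tents r j i (z i)) (continuous_prod_tents r j) h0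

lemma vanishesFar_convProd_tents {r : ℕ} (hr : 0 < r) (j : Fin (n + 1) → ℤ) :
    VanishesFar fun y : Fin n → ℝ => convProd (tents r j) y := by
  obtain ⟨M, hM, h0⟩ := prod_tents_eq_zero hr j
  exact ⟨2 * M, fun y hy =>
    integral_diag_eq_zero (H := fun z => ∏ i, tents r j i (z i)) h0 y hM hy⟩

/-- A continuous compactly supported function is uniformly approximated by combinations of
`convProd`s of tents, with error controlled by the same family. -/
lemma exists_convProd_approx {f : (Fin n → ℝ) → ℝ} (hf : Continuous f) (hs : HasCompactSupport f) :
    ∃ R : ℕ, ∀ ε : ℝ, 0 < ε → ∃ r : ℕ, 0 < r ∧ ∃ b : (Fin (n + 1) → ℤ) → ℝ, ∀ y,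
      |f y - ∑ j ∈ gridBox n r R, b j * convProd (tents r j) y|
        ≤ ε * ∑ j ∈ gridBox n r R, convProd (tents r j) y := by
  obtain ⟨R', hR'⟩ := hs.vanishesFar
  obtain ⟨R₀, hR₀⟩ := exists_nat_ge R'
  have hR : ∀ y : Fin n → ℝ, (R₀ : ℝ) < ‖y‖ → f y = 0 := fun y hy => hR' y (hR₀.trans_lt hy)
  set C := ∫ x, tent x with hCdef
  set H : (Fin (n + 1) → ℝ) → ℝ := fun z => tent (z 0) * f fun i => z i.castSucc - z i.succ with hH
  have ht := continuous_tent
  have hHc : Continuous H := by fun_prop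
  have hH0 : ∀ z i, ((1 + n * R₀ : ℕ) : ℝ) < |z i| → H z = 0 := by
    intro z i hi
    by_contra hne
    have hz0 : |z 0| ≤ 1 := by
      by_contra! h
      exact hne (by simp only [hH]; rw [tent_eq_zero h.le, zero_mul])
    have hd : ∀ i : Fin n, |z i.castSucc - z i.succ| ≤ R₀ := by
      intro i
      by_contra! h
      refine hne ?_
      simp only [hH]
      rw [hR _ (h.trans_le (norm_le_pi_norm (fun i : Fin n => z i.castSucc - z i.succ) i)), mul_zero]
    have hall : ∀ i : Fin (n + 1), |z i| ≤ 1 + (i : ℕ) * R₀ := by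
      intro i
      induction i using Fin.induction with
      | zero => simpa using hz0
      | succ i ih =>
        have h1 := abs_sub_abs_le_abs_sub (z i.succ) (z i.castSucc)
        rw [abs_sub_comm] at h1
        have h2 := hd i
        simp only [Fin.val_castSucc, Fin.val_succ] at ih ⊢
        push_cast
        linarith
    have h1 := hall i
    have h2 : ((i : ℕ) : ℝ) ≤ n := by exact_mod_cast Nat.lt_succ_iff.1 i.2
    have h3 : (0 : ℝ) ≤ R₀ := Nat.cast_nonneg _
    push_cast at hi
    nlinarith
  have hIH : ∀ y, ∫ s, H (ofDiffs s y) = C * f y := by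
    intro y
    simp only [hH, ofDiffs_zero, ofDiffs_sub]
    rw [integral_mul_const]
  have hC : 0 < C := by
    refine continuous_tent.integral_pos_of_hasCompactSupport_nonneg_nonzero
      ?_ (fun x => le_max_left _ _) (x := 0) (by simp [tent])
    exact HasCompactSupport.intro (isCompact_Icc (a := -1) (b := 1)) fun x hx =>
      tent_eq_zero (not_lt.1 fun h => hx (abs_le.1 h.le))
  refine ⟨1 + n * R₀, fun ε hε => ?_⟩
  obtain ⟨r, hr, b, hb⟩ := exists_tents_approx hHc hH0 (mul_pos hC hε)
  refine ⟨r, hr, fun j => b j / C, fun y => ?_⟩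
  have hInt : ∀ j : Fin (n + 1) → ℤ, Integrable fun s => ∏ i, tents r j i (ofDiffs s y i) := by
    intro j
    obtain ⟨M, hM, h0⟩ := prod_tents_eq_zero hr j
    exact integrable_diag (H := fun z => ∏ i, tents r j i (z i)) (continuous_prod_tents r j) h0 y
  have hHi := integrable_diag hHc hH0 y
  have hSi : Integrable fun s => ∑ j ∈ gridBox n r (1 + n * R₀),
      b j * ∏ i, tents r j i (ofDiffs s y i) :=
    integrable_finsetSum _ fun j _ => (hInt j).const_mul _
  have key := abs_integral_le_integral_abs (μ := volume)
    (f := fun s => H (ofDiffs s y) - ∑ j ∈ gridBox n r (1 + n * R₀),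
      b j * ∏ i, tents r j i (ofDiffs s y i))
  have key2 := key.trans (integral_mono (hHi.sub hSi).abs
    ((integrable_finsetSum _ fun j _ => hInt j).const_mul (C * ε)) fun s => hb (ofDiffs s y))
  rw [integral_sub hHi hSi, hIH, integral_const_mul, integral_finsetSum _ fun j _ => hInt j,
    integral_finsetSum _ fun j _ => (hInt j).const_mul _] at key2
  simp only [integral_const_mul] at key2
  have e : C * f y - ∑ j ∈ gridBox n r (1 + n * R₀), b j * ∫ s, ∏ i, tents r j i (ofDiffs s y i)
      = C * (f y - ∑ j ∈ gridBox n r (1 + n * R₀), b j / C * convProd (tents r j) y) := by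
    rw [mul_sub, Finset.mul_sum]
    congr 1
    refine Finset.sum_congr rfl fun j _ => ?_
    rw [← mul_assoc, mul_div_cancel₀ _ hC.ne']; rfl
  rw [e, abs_mul, abs_of_pos hC, mul_assoc] at key2
  exact le_of_mul_le_mul_left key2 hC

lemma tendsto_corrAvg_of_tents {a : ℕ → ℕ} {α : ℝ} {u : ℕ → ℕ} (hu : ∀ᶠ m in atTop, 1 ≤ u m)
    (hα : ∀ r : ℕ, 0 < r → ∀ j : Fin (n + 1) → ℤ,
      Tendsto (fun m => corrAvg a n (convProd (tents r j)) (u m) α) atTop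
        (nhds (∏ i, ∫ z, tents r j i z)))
    {f : (Fin n → ℝ) → ℝ} (hf : Continuous f) (hs : HasCompactSupport f) :
    Tendsto (fun m => corrAvg a n f (u m) α) atTop (nhds (∫ y, f y)) := by
  obtain ⟨R, hR⟩ := exists_convProd_approx hf hs
  set D : ℝ := ((2 * R + 1) * ∫ x, tent x) ^ (n + 1) with hD
  have hD0 : 0 ≤ D := by
    have : 0 ≤ ∫ x, tent x := integral_nonneg fun x => le_max_left _ _
    positivity
  have hfi : Integrable f := hf.integrable_of_hasCompactSupport hs
  have main : ∀ ε : ℝ, 0 < ε → ∃ lo hi : ℕ → ℝ, ∃ l h : ℝ,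
      (∀ᶠ m in atTop, lo m ≤ corrAvg a n f (u m) α ∧ corrAvg a n f (u m) α ≤ hi m) ∧
      Tendsto lo atTop (nhds l) ∧ Tendsto hi atTop (nhds h) ∧
      (∫ y, f y) - 2 * ε * D ≤ l ∧ h ≤ (∫ y, f y) + 2 * ε * D := by
    intro ε hε
    obtain ⟨r, hr, b, hb⟩ := hR ε hε
    set J := gridBox n r R
    have hG := fun j => vanishesFar_convProd_tents (n := n) hr j
    have hI := fun j => integrable_convProd_tents (n := n) hr j
    set P : (Fin (n + 1) → ℤ) → ℝ := fun j => ∏ i, ∫ z, tents r j i z with hP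
    have hPD : ∑ j ∈ J, P j ≤ D := sum_prod_integral_tents_le R hr
    have hIP : ∀ j, ∫ y : Fin n → ℝ, convProd (tents r j) y = P j := integral_convProd_tents hr
    have hlim : ∀ t : ℝ, Tendsto (fun m => corrAvg a n
        (fun y => ∑ j ∈ J, (b j + t) * convProd (tents r j) y) (u m) α) atTop
        (nhds (∑ j ∈ J, (b j + t) * P j)) := by
      intro t
      refine (tendsto_finsetSum J fun j _ => (hα r hr j).const_mul (b j + t)).congr' ?_
      filter_upwards [hu] with m hm
      exact (corrAvg_sum_mul _ (fun j _ => hG j) hm).symm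
    have hInt : ∀ t : ℝ, ∫ y, ∑ j ∈ J, (b j + t) * convProd (tents r j) y
        = ∑ j ∈ J, (b j + t) * P j := by
      intro t
      rw [integral_finsetSum _ fun j _ => (hI j).const_mul _]
      simp only [integral_const_mul, hIP]
    have hsplit : ∀ t y, ∑ j ∈ J, (b j + t) * convProd (tents r j) y
        = ∑ j ∈ J, b j * convProd (tents r j) y + t * ∑ j ∈ J, convProd (tents r j) y := by
      intro t y
      simp only [add_mul, Finset.sum_add_distrib, Finset.mul_sum]
    have hlo : ∀ y, ∑ j ∈ J, (b j + -ε) * convProd (tents r j) y ≤ f y := by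
      intro y
      rw [hsplit]; linarith [(abs_le.1 (hb y)).1]
    have hhi : ∀ y, f y ≤ ∑ j ∈ J, (b j + ε) * convProd (tents r j) y := by
      intro y
      rw [hsplit]; linarith [(abs_le.1 (hb y)).2]
    have hgi : ∀ t : ℝ, Integrable fun y : Fin n → ℝ =>
        ∑ j ∈ J, (b j + t) * convProd (tents r j) y :=
      fun t => integrable_finsetSum _ fun j _ => (hI j).const_mul _
    have h1 := integral_mono (hgi (-ε)) hfi hlo
    have h2 := integral_mono hfi (hgi ε) hhi
    have h3 : ∑ j ∈ J, (b j + ε) * P j = ∑ j ∈ J, (b j + -ε) * P j + 2 * ε * ∑ j ∈ J, P j := by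
      rw [Finset.mul_sum, ← Finset.sum_add_distrib]
      exact Finset.sum_congr rfl fun j _ => by ring
    simp only [hInt] at h1 h2
    have h4 : 2 * ε * ∑ j ∈ J, P j ≤ 2 * ε * D := by gcongr
    refine ⟨_, _, _, _, ?_, hlim (-ε), hlim ε, by linarith, by linarith⟩
    filter_upwards [hu] with m hm
    exact ⟨corrAvg_mono (VanishesFar.sum_mul _ fun j _ => hG j) hs.vanishesFar hlo hm,
      corrAvg_mono hs.vanishesFar (VanishesFar.sum_mul _ fun j _ => hG j) hhi hm⟩
  refine tendsto_order.2 ⟨fun q hq => ?_, fun q hq => ?_⟩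
  · obtain ⟨lo, hi, l, h, hev, hl, -, hll, -⟩ :=
      main (((∫ y, f y) - q) / (4 * (D + 1))) (div_pos (by linarith) (by linarith))
    have : q < l := by
      refine lt_of_lt_of_le ?_ hll
      have : 2 * (((∫ y, f y) - q) / (4 * (D + 1))) * D = ((∫ y, f y) - q) * (D / (2 * (D + 1))) := by
        field_simp; ring
      rw [this]
      have h5 : D / (2 * (D + 1)) < 1 := by rw [div_lt_one (by linarith)]; linarith
      nlinarith
    filter_upwards [hev, hl.eventually (lt_mem_nhds this)] with m h1 h2 using h2.trans_le h1.1
  · obtain ⟨lo, hi, l, h, hev, -, hh, -, hhh⟩ :=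
      main ((q - (∫ y, f y)) / (4 * (D + 1))) (div_pos (by linarith) (by linarith))
    have : h < q := by
      refine lt_of_le_of_lt hhh ?_
      have : 2 * ((q - (∫ y, f y)) / (4 * (D + 1))) * D = (q - (∫ y, f y)) * (D / (2 * (D + 1))) := by
        field_simp; ring
      rw [this]
      have h5 : D / (2 * (D + 1)) < 1 := by rw [div_lt_one (by linarith)]; linarith
      nlinarith
    filter_upwards [hev, hh.eventually (gt_mem_nhds this)] with m h1 h2 using h1.2.trans_lt h2

end subsequence

section dilation

variable {n : ℕ}

/-- Dilations close to the identity move a test function by little, uniformly relative to a fixed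
test function. -/
lemma exists_dilation_bound {f : (Fin n → ℝ) → ℝ} (hf : Continuous f) (hs : HasCompactSupport f) :
    ∃ w : (Fin n → ℝ) → ℝ, Continuous w ∧ HasCompactSupport w ∧
      ∀ ε : ℝ, 0 < ε → ∃ η : ℝ, 0 < η ∧ ∀ ρ : ℝ, |ρ - 1| < η → ∀ y,
        |f (ρ • y) - f y| ≤ ε * w y := by
  obtain ⟨R', hR'⟩ := hs.vanishesFar
  set R := max R' 0
  have hR0 : 0 ≤ R := le_max_right _ _
  have hR : ∀ y : Fin n → ℝ, R < ‖y‖ → f y = 0 := fun y hy => hR' y ((le_max_left _ _).trans_lt hy)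
  refine ⟨fun y => max 0 (2 * R + 1 - ‖y‖), by fun_prop, ?_, fun ε hε => ?_⟩
  · refine HasCompactSupport.intro (isCompact_closedBall (0 : Fin n → ℝ) (2 * R + 1)) fun y hy => ?_
    rw [mem_closedBall_zero_iff, not_le] at hy
    exact max_eq_left (by linarith)
  · obtain ⟨δ, hδ, hH⟩ := Metric.uniformContinuous_iff.1 (hs.uniformContinuous_of_continuous hf) ε hε
    refine ⟨min (1 / 2) (δ / (2 * R + 1)), by positivity, fun ρ hρ y => ?_⟩
    obtain ⟨h1, h2⟩ := lt_min_iff.1 hρ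
    have hρ' : 1 / 2 < ρ := by linarith [(abs_lt.1 h1).1]
    by_cases hy : ‖y‖ ≤ 2 * R
    · have hd : dist (ρ • y) y < δ := by
        have : ρ • y - y = (ρ - 1) • y := by rw [sub_smul, one_smul]
        rw [dist_eq_norm, this, norm_smul, Real.norm_eq_abs]
        rw [lt_div_iff₀ (by linarith)] at h2
        nlinarith [abs_nonneg (ρ - 1)]
      have h3 := hH hd
      rw [Real.dist_eq] at h3
      refine h3.le.trans (le_mul_of_one_le_right hε.le ?_)
      exact le_max_of_le_right (by linarith)
    · push Not at hy
      rw [hR y (by linarith), hR (ρ • y), sub_zero, abs_zero]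
      · exact mul_nonneg hε.le (le_max_left _ _)
      · rw [norm_smul, Real.norm_eq_abs, abs_of_pos (by linarith)]
        nlinarith

lemma VanishesFar.comp_smul {f : (Fin n → ℝ) → ℝ} (hf : VanishesFar f) {ρ : ℝ} (hρ : 0 < ρ) :
    VanishesFar fun y => f (ρ • y) := by
  obtain ⟨R, hR⟩ := hf
  refine ⟨R / ρ, fun y hy => hR _ ?_⟩
  rw [norm_smul, Real.norm_eq_abs, abs_of_pos hρ]
  rwa [div_lt_iff₀' hρ] at hy

variable {a : ℕ → ℕ} {α : ℝ}

lemma mul_corrAvg {f : (Fin n → ℝ) → ℝ} {A N : ℕ} (hA : 1 ≤ A) :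
    (A : ℝ) * corrAvg a n (fun y => f (((N : ℝ) / A) • y)) A α
      = ∑ x ∈ injTuples (n + 1) (Finset.Icc 1 A), ∑' m : Fin n → ℤ,
        f fun i => (N : ℝ) * (m i + α * ((a (x i.castSucc) : ℝ) - a (x i.succ))) := by
  have hA' : (A : ℝ) ≠ 0 := by positivity
  rw [corrAvg, ← mul_assoc, mul_one_div_cancel hA', one_mul]
  refine Finset.sum_congr rfl fun x _ => ?_
  congr 1; ext m
  congr 1; ext i
  simp only [Pi.smul_apply, smul_eq_mul]
  field_simp

lemma mul_corrAvg_mono {f : (Fin n → ℝ) → ℝ} (hf : ∀ y, 0 ≤ f y) {A B N : ℕ} (hA : 1 ≤ A)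
    (hAB : A ≤ B) :
    (A : ℝ) * corrAvg a n (fun y => f (((N : ℝ) / A) • y)) A α
      ≤ B * corrAvg a n (fun y => f (((N : ℝ) / B) • y)) B α := by
  rw [mul_corrAvg hA, mul_corrAvg (hA.trans hAB)]
  refine Finset.sum_le_sum_of_subset_of_nonneg (fun x hx => ?_)
    fun x _ _ => tsum_nonneg fun m => hf _
  rw [mem_injTuples] at hx ⊢
  exact ⟨fun i => Finset.Icc_subset_Icc le_rfl hAB (hx.1 i), hx.2⟩

lemma mul_corrAvg_self {f : (Fin n → ℝ) → ℝ} {N : ℕ} (hN : 1 ≤ N) :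
    (N : ℝ) * corrAvg a n (fun y => f (((N : ℝ) / N) • y)) N α = N * corrAvg a n f N α := by
  have : (N : ℝ) ≠ 0 := by positivity
  simp [div_self this]

end dilation

lemma exists_pow_interpolation {J : ℕ} (hJ : J ≠ 0) : ∃ φ : ℕ → ℕ, Tendsto φ atTop atTop ∧
    ∀ N, φ N ^ J ≤ N ∧ N ≤ (φ N + 1) ^ J := by
  have hJ' : (0 : ℝ) < J := by positivity
  refine ⟨fun N => ⌊(N : ℝ) ^ (1 / (J : ℝ))⌋₊, ?_, fun N => ?_⟩
  · exact tendsto_nat_floor_atTop.comp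
      ((tendsto_rpow_atTop (by positivity)).comp tendsto_natCast_atTop_atTop)
  · have h0 : (0 : ℝ) ≤ (N : ℝ) ^ (1 / (J : ℝ)) := by positivity
    have hN : ((N : ℝ) ^ (1 / (J : ℝ))) ^ J = N := by
      rw [one_div, Real.rpow_inv_natCast_pow (Nat.cast_nonneg _) hJ]
    have h1 := pow_le_pow_left₀ (Nat.cast_nonneg _) (Nat.floor_le h0) J
    have h2 := pow_le_pow_left₀ h0 (Nat.lt_floor_add_one ((N : ℝ) ^ (1 / (J : ℝ)))).le J
    rw [hN] at h1 h2
    exact ⟨by exact_mod_cast h1, by exact_mod_cast h2⟩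

section interpolation

variable {n : ℕ} {a : ℕ → ℕ} {α : ℝ}

/-- Comparison of `corrAvg` at `N` with its values at nearby `A ≤ N ≤ B`. -/
lemma corrAvg_sandwich {f w : (Fin n → ℝ) → ℝ} (hf : VanishesFar f) (hw : VanishesFar w)
    (hf0 : ∀ y, 0 ≤ f y) {ε η : ℝ}
    (hη : ∀ ρ : ℝ, |ρ - 1| < η → ∀ y, |f (ρ • y) - f y| ≤ ε * w y) {A B N : ℕ} (hA : 1 ≤ A)
    (hAN : A ≤ N) (hNB : N ≤ B) (h1 : |(N : ℝ) / A - 1| < η) (h2 : |(N : ℝ) / B - 1| < η) :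
    (A : ℝ) / N * (corrAvg a n f A α - ε * corrAvg a n w A α) ≤ corrAvg a n f N α ∧
    corrAvg a n f N α ≤ B / N * (corrAvg a n f B α + ε * corrAvg a n w B α) := by
  have hN : 1 ≤ N := hA.trans hAN
  have hB : 1 ≤ B := hN.trans hNB
  have hA0 : (0 : ℝ) < A := by positivity
  have hB0 : (0 : ℝ) < B := by positivity
  have hN0 : (0 : ℝ) < N := by positivity
  have hvf : ∀ t, VanishesFar fun y => f y + t * w y := by
    intro t
    obtain ⟨R₁, hR₁⟩ := hf
    obtain ⟨R₂, hR₂⟩ := hw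
    refine ⟨max R₁ R₂, fun y hy => ?_⟩
    simp [hR₁ y ((le_max_left _ _).trans_lt hy), hR₂ y ((le_max_right _ _).trans_lt hy)]
  have m1 := mul_corrAvg_mono (a := a) (α := α) (N := N) hf0 hA hAN
  have m2 := mul_corrAvg_mono (a := a) (α := α) (N := N) hf0 hN hNB
  rw [mul_corrAvg_self hN] at m1 m2
  have l1 := corrAvg_mono (a := a) (α := α) (hvf (-ε)) (hf.comp_smul (div_pos hN0 hA0))
    (fun y => by linarith [(abs_le.1 (hη _ h1 y)).1]) hA
  have l2 := corrAvg_mono (a := a) (α := α) (hf.comp_smul (div_pos hN0 hB0)) (hvf ε)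
    (fun y => by linarith [(abs_le.1 (hη _ h2 y)).2]) hB
  rw [corrAvg_add_mul hf hw _ hA] at l1
  rw [corrAvg_add_mul hf hw _ hB] at l2
  constructor
  · rw [div_mul_eq_mul_div, div_le_iff₀ hN0, mul_comm (corrAvg a n f N α)]
    refine le_trans ?_ m1
    exact mul_le_mul_of_nonneg_left (by linarith) hA0.le
  · rw [div_mul_eq_mul_div, le_div_iff₀ hN0, mul_comm (corrAvg a n f N α)]
    exact m2.trans (mul_le_mul_of_nonneg_left l2 hB0.le)

lemma tendsto_corrAvg_of_nonneg {J : ℕ} (hJ : J ≠ 0)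
    (hα : ∀ f : (Fin n → ℝ) → ℝ, Continuous f → HasCompactSupport f →
      Tendsto (fun m => corrAvg a n f (m ^ J) α) atTop (nhds (∫ y, f y)))
    {f : (Fin n → ℝ) → ℝ} (hf : Continuous f) (hs : HasCompactSupport f) (hf0 : ∀ y, 0 ≤ f y) :
    Tendsto (fun N => corrAvg a n f N α) atTop (nhds (∫ y, f y)) := by
  obtain ⟨w, hwc, hws, hw⟩ := exists_dilation_bound hf hs
  obtain ⟨φ, hφ, hφN⟩ := exists_pow_interpolation hJ
  have hφ' : Tendsto (fun N => φ N + 1) atTop atTop := (tendsto_add_atTop_nat 1).comp hφ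
  have hφpos : ∀ᶠ N in atTop, 1 ≤ φ N := hφ.eventually_ge_atTop 1
  have hq : Tendsto (fun N => ((φ N : ℝ) / (φ N + 1)) ^ J) atTop (nhds 1) := by
    simpa using ((tendsto_natCast_div_add_atTop (1 : ℝ)).comp hφ).pow J
  have hAN : Tendsto (fun N : ℕ => ((φ N ^ J : ℕ) : ℝ) / N) atTop (nhds 1) := by
    refine tendsto_of_tendsto_of_tendsto_of_le_of_le' hq tendsto_const_nhds ?_ ?_
    · filter_upwards [eventually_ge_atTop 1] with N hN
      have hN0 : (0 : ℝ) < N := by positivity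
      rw [div_pow]; push_cast
      refine div_le_div_of_nonneg_left (by positivity) hN0 ?_
      exact_mod_cast (hφN N).2
    · filter_upwards [eventually_ge_atTop 1] with N hN
      have hN0 : (0 : ℝ) < N := by positivity
      rw [div_le_one hN0]
      exact_mod_cast (hφN N).1
  have hNB : Tendsto (fun N : ℕ => (N : ℝ) / (((φ N + 1) ^ J : ℕ) : ℝ)) atTop (nhds 1) := by
    refine tendsto_of_tendsto_of_tendsto_of_le_of_le' hq tendsto_const_nhds ?_ ?_
    · refine Eventually.of_forall fun N => ?_
      rw [div_pow]; push_cast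
      gcongr
      exact_mod_cast (hφN N).1
    · refine Eventually.of_forall fun N => ?_
      rw [div_le_one (by positivity)]
      exact_mod_cast (hφN N).2
  have hNA : Tendsto (fun N : ℕ => (N : ℝ) / ((φ N ^ J : ℕ) : ℝ)) atTop (nhds 1) := by
    simpa using hAN.inv₀ one_ne_zero
  have hBN : Tendsto (fun N : ℕ => (((φ N + 1) ^ J : ℕ) : ℝ) / N) atTop (nhds 1) := by
    simpa using hNB.inv₀ one_ne_zero
  set I := ∫ y, f y
  set W := ∫ y, w y
  have key : ∀ ε : ℝ, 0 < ε → ∃ lo hi : ℕ → ℝ,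
      (∀ᶠ N in atTop, lo N ≤ corrAvg a n f N α ∧ corrAvg a n f N α ≤ hi N) ∧
      Tendsto lo atTop (nhds (I - ε * W)) ∧ Tendsto hi atTop (nhds (I + ε * W)) := by
    intro ε hε
    obtain ⟨η, hη, hηw⟩ := hw ε hε
    have hnear : ∀ {v : ℕ → ℝ}, Tendsto v atTop (nhds 1) → ∀ᶠ N in atTop, |v N - 1| < η :=
      fun hv => by simpa [Real.dist_eq] using (Metric.tendsto_nhds.1 hv) η hη
    refine ⟨_, _, ?_,
      by simpa using hAN.mul (((hα f hf hs).comp hφ).sub (((hα w hwc hws).comp hφ).const_mul ε)),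
      by simpa using hBN.mul (((hα f hf hs).comp hφ').add (((hα w hwc hws).comp hφ').const_mul ε))⟩
    filter_upwards [hφpos, hnear hNA, hnear hNB] with N h1 h2 h3
    simpa using corrAvg_sandwich (a := a) (α := α) hs.vanishesFar hws.vanishesFar hf0 hηw
      (Nat.one_le_pow J _ h1) (hφN N).1 (hφN N).2 h2 h3
  have hsmall : ∀ q : ℝ, 0 < q → q / (|W| + 1) * W < q ∧ -q < q / (|W| + 1) * W := by
    intro q hq
    have h1 : 0 < |W| + 1 := by positivity
    have : |q / (|W| + 1) * W| < q := by
      rw [abs_mul, abs_of_pos (by positivity), div_mul_eq_mul_div, div_lt_iff₀ h1]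
      nlinarith
    exact ⟨(abs_lt.1 this).2, (abs_lt.1 this).1⟩
  refine tendsto_order.2 ⟨fun q hq => ?_, fun q hq => ?_⟩
  · obtain ⟨lo, hi, hev, hl, -⟩ := key ((I - q) / (|W| + 1)) (div_pos (by linarith) (by positivity))
    have := (hsmall (I - q) (by linarith)).1
    filter_upwards [hev, hl.eventually (lt_mem_nhds (show q < _ by linarith))] with N h1 h2
      using h2.trans_le h1.1
  · obtain ⟨lo, hi, hev, -, hh⟩ := key ((q - I) / (|W| + 1)) (div_pos (by linarith) (by positivity))
    have := (hsmall (q - I) (by linarith)).1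
    filter_upwards [hev, hh.eventually (gt_mem_nhds (show _ < q by linarith))] with N h1 h2
      using h1.2.trans_lt h2

lemma tendsto_corrAvg_of_pow {J : ℕ} (hJ : J ≠ 0)
    (hα : ∀ f : (Fin n → ℝ) → ℝ, Continuous f → HasCompactSupport f →
      Tendsto (fun m => corrAvg a n f (m ^ J) α) atTop (nhds (∫ y, f y)))
    {f : (Fin n → ℝ) → ℝ} (hf : Continuous f) (hs : HasCompactSupport f) :
    Tendsto (fun N => corrAvg a n f N α) atTop (nhds (∫ y, f y)) := by
  have hs₁ : HasCompactSupport fun y => max (f y) 0 := hs.comp_left (g := fun x => max x 0) (by simp)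
  have hs₂ : HasCompactSupport fun y => max (-f y) 0 :=
    hs.comp_left (g := fun x => max (-x) 0) (by simp)
  have hc₁ : Continuous fun y => max (f y) 0 := by fun_prop
  have hc₂ : Continuous fun y => max (-f y) 0 := by fun_prop
  have h₁ := tendsto_corrAvg_of_nonneg hJ hα hc₁ hs₁ fun y => le_max_right _ _
  have h₂ := tendsto_corrAvg_of_nonneg hJ hα hc₂ hs₂ fun y => le_max_right _ _
  have he : ∀ y, f y = max (f y) 0 + -1 * max (-f y) 0 := by
    intro y
    rcases le_total (f y) 0 with h | h
    · rw [max_eq_right h, max_eq_left (by linarith)]; ring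
    · rw [max_eq_left h, max_eq_right (by linarith)]; ring
  have hI : ∫ y, f y = (∫ y, max (f y) 0) + -1 * ∫ y, max (-f y) 0 := by
    rw [← integral_const_mul, ← integral_add (hc₁.integrable_of_hasCompactSupport hs₁)
      ((hc₂.integrable_of_hasCompactSupport hs₂).const_mul _)]
    exact integral_congr_ae (Eventually.of_forall he)
  rw [hI]
  refine (h₁.add (h₂.const_mul (-1))).congr' ?_
  filter_upwards [eventually_ge_atTop 1] with N hN
  rw [← corrAvg_add_mul hs₁.vanishesFar hs₂.vanishesFar _ hN]
  congr 1
  exact funext fun y => (he y).symm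

end interpolation

theorem ae_tendsto_corrAvg {c : ℝ} (hc : 1 < c) {a : ℕ → ℕ} (hpos : ∀ n, 0 < a n)
    (hlac : ∀ n, c * a n < a (n + 1)) :
    ∀ᵐ α ∂unitVol, ∀ n, ∀ f : (Fin n → ℝ) → ℝ, Continuous f → HasCompactSupport f →
      Tendsto (fun N => corrAvg a n f N α) atTop (nhds (∫ y, f y)) := by
  have hae : ∀ᵐ α ∂unitVol, ∀ (n r : ℕ) (j : Fin (n + 1) → ℤ), 0 < r →
      Tendsto (fun m : ℕ => smoothSum a (tents r j) (m ^ (8 * (n + 1) + 8)) α) atTop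
        (nhds (∏ i, ∫ z, tents r j i z)) := by
    refine ae_all_iff.2 fun n => ae_all_iff.2 fun r => ae_all_iff.2 fun j => ?_
    by_cases hr : 0 < r
    · obtain ⟨M, hM, hb⟩ := exists_bump_tents hr j
      filter_upwards [ae_tendsto_smoothSum hc hpos hlac hM hb] with α hα _ using hα
    · exact Eventually.of_forall fun α h => absurd h hr
  filter_upwards [hae] with α hα n f hf hs
  have hpow : ∀ᶠ m : ℕ in atTop, 1 ≤ m ^ (8 * (n + 1) + 8) :=
    (eventually_ge_atTop 1).mono fun m hm => Nat.one_le_pow _ _ hm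
  refine tendsto_corrAvg_of_pow (J := 8 * (n + 1) + 8) (by omega) (fun f hf hs => ?_) hf hs
  refine tendsto_corrAvg_of_tents hpow (fun r hr j => (hα n r j hr).congr' ?_) hf hs
  obtain ⟨M, hM, hb⟩ := exists_bump_tents hr j
  filter_upwards [hpow] with m hm
  exact (corrAvg_convProd hM hb a hm α).symm

/-- Main theorem: for a lacunary sequence, there is a full-measure set of `α ∈ [0,1]` such
that for all `k ≥ 2` and all smooth compactly supported `f`, the `k`-level correlation
sums `R_k(f,N)(α)` converge to `∫ f`. -/
theorem stmt12 (c : ℝ) (hc : 1 < c) (a : ℕ → ℕ) (ha : ∀ n, 0 < a n)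
    (hlac : ∀ n, c * a n < a (n + 1)) :
    ∀ᵐ α ∂(volume.restrict (Set.Icc (0 : ℝ) 1)),
      ∀ k : ℕ, 2 ≤ k → ∀ f : (Fin (k - 1) → ℝ) → ℝ,
        ContDiff ℝ (⊤ : ℕ∞) f → HasCompactSupport f →
          Tendsto (fun N => Rk a k f N α) atTop
            (nhds (∫ y : Fin (k - 1) → ℝ, f y)) := by
  have h := ae_tendsto_corrAvg hc ha hlac
  rw [unitVol, restrict_Ioc_eq_restrict_Icc] at h
  filter_upwards [h] with α hα k hk f hf hs
  obtain ⟨n, rfl⟩ : ∃ n, k = n + 1 := ⟨k - 1, by omega⟩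
  exact hα n f hf.continuous hs
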